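/- arXiv:quant-ph/0412116 — 2 statements merged into one kernel-verified Lean document; each statement's English description precedes it below -/
import Mathlib

section
/- Groenewold–Lindblad–Ozawa theorem (discrete, finite-dimensional form of Theorem 4): for an instrument I in Kraus form with initial space ℂ^n and final space ℂ^m, the following are equivalent: (a) for every unit vector x ∈ ℂ^n and every ω ∈ Ω with Tr(I_ω(xx*)) > 0, the a posteriori state π_{xx*}(ω) has rank one (the instrument sends pure input states into pure a posteriori states); (b) I_q{ρ; I} ≥ 0 for every density matrix ρ on ℂ^n. -/
open Matrix BigOperators
open scoped Kronecker ComplexOrder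

noncomputable section

/-- A density matrix: positive semidefinite with unit trace. -/
def IsDensityMatrix {ι : Type*} [Fintype ι] (ρ : Matrix ι ι ℂ) : Prop :=
  ρ.PosSemidef ∧ ρ.trace = 1

/-- von Neumann entropy (natural logarithm), via the eigenvalues;
junk value `0` if the matrix is not Hermitian. -/
noncomputable def vnEntropy {ι : Type*} [Fintype ι] [DecidableEq ι]
    (ρ : Matrix ι ι ℂ) : ℝ :=
  if h : ρ.IsHermitian then -∑ i, h.eigenvalues i * Real.log (h.eigenvalues i) else 0

/-- Quantum relative entropy `S(σ|τ)` (natural logarithm), computed in an orthonormal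
eigenbasis of `τ`; junk value `0` if `σ` or `τ` is not Hermitian. -/
noncomputable def relEnt {ι : Type*} [Fintype ι] [DecidableEq ι]
    (σ τ : Matrix ι ι ℂ) : ℝ :=
  if h : σ.IsHermitian ∧ τ.IsHermitian then
    (∑ i, h.1.eigenvalues i * Real.log (h.1.eigenvalues i))
      - ∑ j, (if 0 < h.2.eigenvalues j then
          Real.log (h.2.eigenvalues j) *
            ((star (fun i => h.2.eigenvectorBasis j i)) ⬝ᵥ
              σ.mulVec (fun i => h.2.eigenvectorBasis j i)).re
        else 0)
  else 0

/-- Holevo χ-quantity of an ensemble of states, relative to its barycenter. -/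
noncomputable def holevoChi {ι B : Type*} [Fintype ι] [DecidableEq ι] [Fintype B]
    (q : B → ℝ) (τ : B → Matrix ι ι ℂ) : ℝ :=
  ∑ β, if 0 < q β then q β * relEnt (τ β) (∑ γ, q γ • τ γ) else 0

/-- The action of an instrument in Kraus form: `I_ω(ρ) = ∑ k, V ω k * ρ * (V ω k)ᴴ`. -/
noncomputable def instAct {n m : ℕ} {Ω K : Type*} [Fintype K]
    (V : Ω → K → Matrix (Fin m) (Fin n) ℂ) (ω : Ω)
    (ρ : Matrix (Fin n) (Fin n) ℂ) : Matrix (Fin m) (Fin m) ℂ :=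
  ∑ k, V ω k * ρ * (V ω k)ᴴ

/-- The POVM associated with an instrument in Kraus form: `E_ω = ∑ k, (V ω k)ᴴ * V ω k`. -/
noncomputable def povm {n m : ℕ} {Ω K : Type*} [Fintype K]
    (V : Ω → K → Matrix (Fin m) (Fin n) ℂ) (ω : Ω) : Matrix (Fin n) (Fin n) ℂ :=
  ∑ k, (V ω k)ᴴ * V ω k

/-- Outcome probability `Tr(E_ω ρ)`. -/
noncomputable def probOut {n m : ℕ} {Ω K : Type*} [Fintype K]
    (V : Ω → K → Matrix (Fin m) (Fin n) ℂ) (ρ : Matrix (Fin n) (Fin n) ℂ) (ω : Ω) : ℝ :=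
  ((povm V ω * ρ).trace).re

/-- The a posteriori state `π_ρ(ω) = I_ω(ρ)/Tr(I_ω(ρ))` (junk if the trace vanishes). -/
noncomputable def post {n m : ℕ} {Ω K : Type*} [Fintype K]
    (V : Ω → K → Matrix (Fin m) (Fin n) ℂ) (ω : Ω)
    (ρ : Matrix (Fin n) (Fin n) ℂ) : Matrix (Fin m) (Fin m) ℂ :=
  (((instAct V ω ρ).trace.re)⁻¹ : ℝ) • instAct V ω ρ

/-- The classical (Shannon) input/output mutual information of the ensemble `(p, ρ)`
measured with the POVM of the instrument `V`. -/
noncomputable def Ic {n m : ℕ} {A Ω K : Type*} [Fintype A] [Fintype Ω] [Fintype K]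
    (p : A → ℝ) (ρ : A → Matrix (Fin n) (Fin n) ℂ)
    (V : Ω → K → Matrix (Fin m) (Fin n) ℂ) : ℝ :=
  ∑ α, ∑ ω,
    if 0 < p α * probOut V (ρ α) ω then
      p α * probOut V (ρ α) ω *
        Real.log ((p α * probOut V (ρ α) ω) /
          (p α * probOut V (∑ β, p β • ρ β) ω))
    else 0

/-- Quantum information gain of the instrument `V` at the state `ρ`. -/
noncomputable def infoGain {n m : ℕ} {Ω K : Type*} [Fintype Ω] [Fintype K]
    (V : Ω → K → Matrix (Fin m) (Fin n) ℂ) (ρ : Matrix (Fin n) (Fin n) ℂ) : ℝ :=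
  vnEntropy ρ - ∑ ω, if 0 < (instAct V ω ρ).trace.re then
    (instAct V ω ρ).trace.re * vnEntropy (post V ω ρ) else 0


theorem vnEntropy_eq_sum_negMulLog {ι : Type*} [Fintype ι] [DecidableEq ι]
    {A : Matrix ι ι ℂ} (hA : A.IsHermitian) :
    vnEntropy A = ∑ i, Real.negMulLog (hA.eigenvalues i) := by
  simp [vnEntropy, hA, Real.negMulLog]

theorem vnEntropy_eq_sum_roots_charpoly {ι : Type*} [Fintype ι] [DecidableEq ι]
    {A : Matrix ι ι ℂ} (hA : A.IsHermitian) :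
    vnEntropy A = (A.charpoly.roots.map fun z : ℂ => Real.negMulLog z.re).sum := by
  rw [vnEntropy_eq_sum_negMulLog hA, hA.roots_charpoly_eq_eigenvalues, Multiset.map_map]
  rfl

/-- `A * B` and `B * A` have the same entropy, as their nonzero eigenvalues agree. -/
theorem vnEntropy_mul_comm {ι κ : Type*} [Fintype ι] [DecidableEq ι] [Fintype κ] [DecidableEq κ]
    (A : Matrix ι κ ℂ) (B : Matrix κ ι ℂ) (hAB : (A * B).IsHermitian)
    (hBA : (B * A).IsHermitian) : vnEntropy (A * B) = vnEntropy (B * A) := by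
  rw [vnEntropy_eq_sum_roots_charpoly hAB, vnEntropy_eq_sum_roots_charpoly hBA]
  have key := congrArg
    (fun p : Polynomial ℂ => (p.roots.map fun z : ℂ => Real.negMulLog z.re).sum)
    (Matrix.charpoly_mul_comm' A B)
  have hX (k : ℕ) {p : Polynomial ℂ} (hp : p.Monic) :
      (((Polynomial.X ^ k * p).roots).map fun z : ℂ => Real.negMulLog z.re).sum
        = (p.roots.map fun z : ℂ => Real.negMulLog z.re).sum := by
    rw [Polynomial.roots_mul (mul_ne_zero (by simp) hp.ne_zero)]
    simp [Multiset.nsmul_singleton]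
  simpa [hX _ (Matrix.charpoly_monic _)] using key

/-- **Peierls inequality**: the entropy of a positive semidefinite matrix is at most that of its
diagonal in any orthonormal basis. -/
theorem vnEntropy_le_sum_negMulLog_diag {ι : Type*} [Fintype ι] [DecidableEq ι]
    {A : Matrix ι ι ℂ} (hA : A.PosSemidef) {U : Matrix ι ι ℂ} (hU : U ∈ Matrix.unitaryGroup ι ℂ) :
    vnEntropy A ≤ ∑ j, Real.negMulLog ((Uᴴ * A * U) j j).re := by
  set W : Matrix ι ι ℂ := Uᴴ * (hA.1.eigenvectorUnitary : Matrix ι ι ℂ) with hW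
  have hWmem : W ∈ Matrix.unitaryGroup ι ℂ :=
    mul_mem (Unitary.star_mem hU) hA.1.eigenvectorUnitary.2
  have hrow (j : ι) : ∑ i, Complex.normSq (W j i) = 1 := by
    have h := congrFun (congrFun (Matrix.mem_unitaryGroup_iff.1 hWmem) j) j
    simp only [Matrix.mul_apply, Matrix.star_apply, Matrix.one_apply_eq, Complex.star_def,
      Complex.mul_conj] at h
    exact_mod_cast h
  have hcol (i : ι) : ∑ j, Complex.normSq (W j i) = 1 := by
    have h := congrFun (congrFun (Matrix.mem_unitaryGroup_iff'.1 hWmem) i) i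
    simp only [Matrix.mul_apply, Matrix.star_apply, Matrix.one_apply_eq, Complex.star_def,
      ← Complex.normSq_eq_conj_mul_self] at h
    exact_mod_cast h
  have hdiag (j : ι) :
      ((Uᴴ * A * U) j j).re = ∑ i, Complex.normSq (W j i) • hA.1.eigenvalues i := by
    have h1 : Uᴴ * A * U = W * Matrix.diagonal (RCLike.ofReal ∘ hA.1.eigenvalues) * Wᴴ := by
      conv_lhs => rw [hA.1.spectral_theorem, Unitary.conjStarAlgAut_apply]
      simp [hW, Matrix.conjTranspose_mul, Matrix.mul_assoc, Matrix.star_eq_conjTranspose]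
    rw [h1, Matrix.mul_apply, Complex.re_sum]
    refine Finset.sum_congr rfl fun i _ => ?_
    have h2 : W j i * (hA.1.eigenvalues i : ℂ) * (starRingEnd ℂ) (W j i)
        = (Complex.normSq (W j i) : ℂ) * (hA.1.eigenvalues i : ℂ) := by
      rw [mul_right_comm, Complex.mul_conj]
    rw [Matrix.mul_diagonal]
    refine (congrArg Complex.re h2).trans ?_
    simp
  calc vnEntropy A = ∑ i, (∑ j, Complex.normSq (W j i)) * Real.negMulLog (hA.1.eigenvalues i) := by
        simp [vnEntropy_eq_sum_negMulLog hA.1, hcol]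
    _ = ∑ j, ∑ i, Complex.normSq (W j i) • Real.negMulLog (hA.1.eigenvalues i) := by
        simp_rw [Finset.sum_mul, smul_eq_mul]
        exact Finset.sum_comm
    _ ≤ _ := Finset.sum_le_sum fun j _ => by
        rw [hdiag]
        exact Real.concaveOn_negMulLog.le_map_sum (fun i _ => Complex.normSq_nonneg _) (hrow j)
          fun i _ => hA.eigenvalues_nonneg i

/-- Concavity of the von Neumann entropy. -/
theorem sum_smul_vnEntropy_le {ι Ω : Type*} [Fintype ι] [DecidableEq ι] [Fintype Ω]
    (q : Ω → ℝ) (hq : ∀ ω, 0 ≤ q ω) (hq1 : ∑ ω, q ω = 1) (σ : Ω → Matrix ι ι ℂ)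
    (hσ : ∀ ω, (σ ω).PosSemidef) :
    ∑ ω, q ω * vnEntropy (σ ω) ≤ vnEntropy (∑ ω, q ω • σ ω) := by
  have hD : (∑ ω, q ω • σ ω).IsHermitian :=
    (Matrix.posSemidef_sum _ fun ω _ => (hσ ω).smul (hq ω)).1
  set U : Matrix ι ι ℂ := (hD.eigenvectorUnitary : Matrix ι ι ℂ)
  have hU : U ∈ Matrix.unitaryGroup ι ℂ := hD.eigenvectorUnitary.2
  have hdiag (j : ι) : hD.eigenvalues j = ∑ ω, q ω • ((Uᴴ * σ ω * U) j j).re := by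
    have h := congrFun (congrFun hD.conjStarAlgAut_star_eigenvectorUnitary j) j
    rw [Unitary.conjStarAlgAut_star_apply] at h
    have h' := congrArg Complex.re h
    simp only [Matrix.mul_sum, Matrix.sum_mul, Matrix.sum_apply, Complex.re_sum,
      Matrix.diagonal_apply_eq, Matrix.mul_smul, Matrix.smul_mul, Matrix.smul_apply] at h'
    simpa [U, Matrix.star_eq_conjTranspose] using h'.symm
  have hnn (j : ι) (ω : Ω) : 0 ≤ ((Uᴴ * σ ω * U) j j).re :=
    (Complex.le_def.1 (((hσ ω).conjTranspose_mul_mul_same U).diag_nonneg (i := j))).1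
  rw [vnEntropy_eq_sum_negMulLog hD]
  calc ∑ ω, q ω * vnEntropy (σ ω)
      ≤ ∑ ω, q ω * ∑ j, Real.negMulLog ((Uᴴ * σ ω * U) j j).re :=
        Finset.sum_le_sum fun ω _ => mul_le_mul_of_nonneg_left
          (vnEntropy_le_sum_negMulLog_diag (hσ ω) hU) (hq ω)
    _ = ∑ j, ∑ ω, q ω • Real.negMulLog ((Uᴴ * σ ω * U) j j).re := by
        simp_rw [Finset.mul_sum, smul_eq_mul]
        exact Finset.sum_comm
    _ ≤ _ := Finset.sum_le_sum fun j _ => by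
        rw [hdiag]
        exact Real.concaveOn_negMulLog.le_map_sum (fun ω _ => hq ω) hq1 fun ω _ => hnn j ω

theorem IsDensityMatrix.sum_eigenvalues {ι : Type*} [Fintype ι] [DecidableEq ι]
    {ρ : Matrix ι ι ℂ} (hρ : IsDensityMatrix ρ) : ∑ i, hρ.1.1.eigenvalues i = 1 := by
  have h := hρ.1.1.trace_eq_sum_eigenvalues
  exact Complex.ofReal_injective (by rw [Complex.ofReal_sum]; exact h.symm.trans hρ.2)

theorem IsDensityMatrix.eigenvalues_le_one {ι : Type*} [Fintype ι] [DecidableEq ι]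
    {ρ : Matrix ι ι ℂ} (hρ : IsDensityMatrix ρ) (i : ι) : hρ.1.1.eigenvalues i ≤ 1 := by
  rw [← hρ.sum_eigenvalues]
  exact Finset.single_le_sum (fun j _ => hρ.1.eigenvalues_nonneg j) (Finset.mem_univ i)

theorem IsDensityMatrix.vnEntropy_nonneg {ι : Type*} [Fintype ι] [DecidableEq ι]
    {ρ : Matrix ι ι ℂ} (hρ : IsDensityMatrix ρ) : 0 ≤ vnEntropy ρ := by
  rw [vnEntropy_eq_sum_negMulLog hρ.1.1]
  exact Finset.sum_nonneg fun i _ =>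
    Real.negMulLog_nonneg (hρ.1.eigenvalues_nonneg i) (hρ.eigenvalues_le_one i)

/-- A state has zero entropy exactly when it is pure. -/
theorem IsDensityMatrix.vnEntropy_eq_zero_iff {ι : Type*} [Fintype ι] [DecidableEq ι]
    {ρ : Matrix ι ι ℂ} (hρ : IsDensityMatrix ρ) : vnEntropy ρ = 0 ↔ ρ.rank = 1 := by
  have hsum := hρ.sum_eigenvalues
  rw [vnEntropy_eq_sum_negMulLog hρ.1.1, hρ.1.1.rank_eq_card_non_zero_eigs,
    Finset.sum_eq_zero_iff_of_nonneg fun i _ =>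
      Real.negMulLog_nonneg (hρ.1.eigenvalues_nonneg i) (hρ.eigenvalues_le_one i),
    Fintype.card_eq_one_iff]
  constructor
  · intro h
    have h01 (i : ι) (hi : hρ.1.1.eigenvalues i ≠ 0) : hρ.1.1.eigenvalues i = 1 := by
      have := h i (Finset.mem_univ i)
      simp only [Real.negMulLog, neg_mul, neg_eq_zero, mul_eq_zero, Real.log_eq_zero] at this
      have h0 := hρ.1.eigenvalues_nonneg i
      rcases this with h | h | h | h
      · exact absurd h hi
      · exact absurd h hi
      · exact h
      · linarith
    obtain ⟨i, -, hi⟩ : ∃ i ∈ Finset.univ, hρ.1.1.eigenvalues i ≠ 0 :=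
      Finset.exists_ne_zero_of_sum_ne_zero (by rw [hsum]; exact one_ne_zero)
    refine ⟨⟨i, hi⟩, fun ⟨j, hj⟩ => Subtype.ext ?_⟩
    by_contra hne
    have h2 := Finset.add_le_sum (fun k _ => hρ.1.eigenvalues_nonneg k)
      (Finset.mem_univ i) (Finset.mem_univ j) (Ne.symm hne)
    rw [hsum, h01 i hi, h01 j hj] at h2
    norm_num at h2
  · rintro ⟨⟨i, hi⟩, huniq⟩ j -
    have hz (k : ι) (hk : k ≠ i) : hρ.1.1.eigenvalues k = 0 := by
      by_contra h
      exact hk (congrArg Subtype.val (huniq ⟨k, h⟩))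
    rw [Finset.sum_eq_single i (fun k _ hk => hz k hk) (by simp)] at hsum
    by_cases hj : j = i
    · rw [hj, hsum, Real.negMulLog_one]
    · rw [hz j hj, Real.negMulLog_zero]

theorem IsDensityMatrix.rank_eq_one_of_le {ι : Type*} [Fintype ι] [DecidableEq ι]
    {ρ : Matrix ι ι ℂ} (hρ : IsDensityMatrix ρ) (h : ρ.rank ≤ 1) : ρ.rank = 1 := by
  refine le_antisymm h (Nat.one_le_iff_ne_zero.2 fun h0 => ?_)
  have : ρ = 0 := by
    have h1 : ρ.mulVecLin = 0 := LinearMap.range_eq_bot.1 (Submodule.finrank_eq_zero.1 h0)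
    exact Matrix.ext_of_mulVec_single fun i => by
      rw [Matrix.zero_mulVec]
      exact LinearMap.congr_fun h1 (Pi.single i 1)
  simpa [this] using hρ.2

/-- Linear maps `L k` whose values at each point lie on a common line are either all multiples of
a single one of them or all take values in one fixed line. -/
theorem LinearMap.forall_eq_smul_or_forall_mem_line {𝕜 E F κ : Type*} [Field 𝕜]
    [AddCommGroup E] [Module 𝕜 E] [AddCommGroup F] [Module 𝕜 F] (L : κ → E →ₗ[𝕜] F)
    (h : ∀ x, ∃ v, ∀ k, ∃ c : 𝕜, c • v = L k x) :
    (∃ k₀, ∃ c : κ → 𝕜, ∀ k, L k = c k • L k₀) ∨ ∃ v, ∀ k x, ∃ c : 𝕜, c • v = L k x := by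
  have par {k l : κ} {x : E} (hx : L k x ≠ 0) : ∃ c : 𝕜, L l x = c • L k x := by
    obtain ⟨v, hv⟩ := h x
    obtain ⟨a, ha⟩ := hv k
    obtain ⟨b, hb⟩ := hv l
    have ha0 : a ≠ 0 := by
      rintro rfl
      exact hx (by rw [← ha, zero_smul])
    refine ⟨b * a⁻¹, ?_⟩
    rw [← ha, ← hb, smul_smul, inv_mul_cancel_right₀ ha0]
  by_cases hrank : ∃ k₀ x y, L k₀ x ≠ 0 ∧ ∀ c : 𝕜, L k₀ y ≠ c • L k₀ x
  · left
    obtain ⟨k₀, x, y, hx, hxy⟩ := hrank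
    refine ⟨k₀, ?_⟩
    suffices hsuff : ∀ k, ∃ a : 𝕜, L k = a • L k₀ from Classical.skolem.1 hsuff
    intro k
    have ext_indep {u w : E} {a : 𝕜} (hu : L k₀ u ≠ 0) (hau : L k u = a • L k₀ u)
        (hw : ∀ c : 𝕜, L k₀ w ≠ c • L k₀ u) : L k w = a • L k₀ w := by
      have hw0 : L k₀ w ≠ 0 := by simpa using hw 0
      have huw : L k₀ (u + w) ≠ 0 := fun h0 => hw (-1) (by
        rw [map_add] at h0
        rw [neg_one_smul]
        exact eq_neg_of_add_eq_zero_right h0)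
      obtain ⟨b, hb⟩ := par (l := k) hw0
      obtain ⟨c, hc⟩ := par (l := k) huw
      rw [map_add, map_add, hau, hb, smul_add] at hc
      have hbc : b = c := by
        by_contra hne
        refine hw ((b - c)⁻¹ * (c - a)) ?_
        rw [mul_smul, eq_inv_smul_iff₀ (sub_ne_zero.2 hne), sub_smul, sub_smul]
        rw [sub_eq_sub_iff_add_eq_add, add_comm, hc, add_comm]
      subst hbc
      rw [hb]
      have hac : a • L k₀ u = b • L k₀ u := add_right_cancel hc
      have : a = b := by
        have := sub_eq_zero.2 hac
        rw [← sub_smul] at this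
        exact sub_eq_zero.1 ((smul_eq_zero.1 this).resolve_right hu)
      rw [this]
    obtain ⟨a, ha⟩ := par (l := k) hx
    have hay := ext_indep hx ha hxy
    have hy : L k₀ y ≠ 0 := by simpa using hxy 0
    refine ⟨a, LinearMap.ext fun z => ?_⟩
    have hnz (z : E) (hz : L k₀ z ≠ 0) : L k z = a • L k₀ z := by
      by_cases hzx : ∃ c : 𝕜, L k₀ z = c • L k₀ x
      · obtain ⟨c, hc⟩ := hzx
        have hc0 : c ≠ 0 := by
          rintro rfl
          exact hz (by rw [hc, zero_smul])
        refine ext_indep hy hay fun d hd => ?_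
        have hd0 : d ≠ 0 := by
          rintro rfl
          exact hz (by rw [hd, zero_smul])
        refine hxy (d⁻¹ * c) ?_
        rw [mul_smul, ← hc, hd, inv_smul_smul₀ hd0]
      · exact ext_indep hx ha fun c hc => hzx ⟨c, hc⟩
    rw [LinearMap.smul_apply]
    by_cases hz : L k₀ z = 0
    · have := hnz (z + x) (by simpa [hz] using hx)
      rw [map_add, map_add, hz, ha, zero_add] at this
      rw [hz, smul_zero]
      simpa using this
    · exact hnz z hz
  · right
    push Not at hrank
    by_cases h0 : ∃ k₀ x₀, L k₀ x₀ ≠ 0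
    · obtain ⟨k₀, x₀, hx₀⟩ := h0
      refine ⟨L k₀ x₀, fun k x => ?_⟩
      by_contra hcon
      push Not at hcon
      have hkx : L k x ≠ 0 := by simpa using (hcon 0).symm
      have h1 : L k x₀ = 0 := by
        by_contra hne
        obtain ⟨c, hc⟩ := par (l := k) hx₀
        obtain ⟨d, hd⟩ := hrank k x₀ x hne
        exact hcon (d * c) (by rw [hd, hc, smul_smul])
      have h2 : L k₀ x = 0 := by
        by_contra hne
        obtain ⟨c, hc⟩ := par (l := k) hne
        obtain ⟨d, hd⟩ := hrank k₀ x₀ x hx₀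
        exact hcon (c * d) (by rw [hc, hd, smul_smul])
      obtain ⟨c, hc⟩ := par (k := k₀) (l := k) (x := x + x₀) (by simpa [h2] using hx₀)
      rw [map_add, map_add, h1, h2, add_zero, zero_add] at hc
      exact hcon c hc.symm
    · push Not at h0
      exact ⟨0, fun k x => ⟨0, by rw [h0 k x, smul_zero]⟩⟩

section Instrument

variable {Ω K : Type*} [Fintype K] {n m : ℕ} (V : Ω → K → Matrix (Fin m) (Fin n) ℂ)

theorem instAct_posSemidef {ρ : Matrix (Fin n) (Fin n) ℂ} (hρ : ρ.PosSemidef) (ω : Ω) :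
    (instAct V ω ρ).PosSemidef :=
  Matrix.posSemidef_sum _ fun k _ => hρ.mul_mul_conjTranspose_same (V ω k)

theorem instAct_trace_eq_ofReal {ρ : Matrix (Fin n) (Fin n) ℂ} (hρ : ρ.PosSemidef) (ω : Ω) :
    (instAct V ω ρ).trace = ((instAct V ω ρ).trace.re : ℂ) :=
  Complex.eq_re_of_ofReal_le (r := 0) (by
    rw [Complex.ofReal_zero]
    exact (instAct_posSemidef V hρ ω).trace_nonneg)

theorem instAct_trace_re_nonneg {ρ : Matrix (Fin n) (Fin n) ℂ} (hρ : ρ.PosSemidef) (ω : Ω) :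
    0 ≤ (instAct V ω ρ).trace.re :=
  (Complex.le_def.1 (instAct_posSemidef V hρ ω).trace_nonneg).1

theorem post_isDensityMatrix {ρ : Matrix (Fin n) (Fin n) ℂ} (hρ : ρ.PosSemidef) {ω : Ω}
    (hω : 0 < (instAct V ω ρ).trace.re) : IsDensityMatrix (post V ω ρ) := by
  refine ⟨(instAct_posSemidef V hρ ω).smul (inv_nonneg.2 hω.le), ?_⟩
  rw [post, Matrix.trace_smul, instAct_trace_eq_ofReal V hρ ω, Complex.ofReal_re,
    Complex.real_smul, ← Complex.ofReal_mul, inv_mul_cancel₀ hω.ne', Complex.ofReal_one]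

theorem isDensityMatrix_vecMulVec {x : Fin n → ℂ} (hx : star x ⬝ᵥ x = 1) :
    IsDensityMatrix (vecMulVec x (star x)) :=
  ⟨Matrix.posSemidef_vecMulVec_self_star x, by rw [Matrix.trace_vecMulVec, dotProduct_comm, hx]⟩

theorem vnEntropy_vecMulVec {x : Fin n → ℂ} (hx : star x ⬝ᵥ x = 1) :
    vnEntropy (vecMulVec x (star x)) = 0 := by
  have h := isDensityMatrix_vecMulVec hx
  exact h.vnEntropy_eq_zero_iff.2 (h.rank_eq_one_of_le (Matrix.rank_vecMulVec_le _ _))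

theorem instAct_vecMulVec (x : Fin n → ℂ) (ω : Ω) :
    instAct V ω (vecMulVec x (star x))
      = Matrix.of (fun i k => (V ω k *ᵥ x) i) * (Matrix.of fun i k => (V ω k *ᵥ x) i)ᴴ := by
  ext i j
  simp [instAct, Matrix.mul_vecMulVec, Matrix.vecMulVec_mul, Matrix.sum_apply, Matrix.mul_apply,
    Matrix.vecMulVec_apply, ← Matrix.star_mulVec]

/-- If the output on a pure state has rank at most one, all Kraus operators send the input vector
to a common line. -/
theorem exists_line_of_rank_le_one {x : Fin n → ℂ} {ω : Ω}
    (h : (instAct V ω (vecMulVec x (star x))).rank ≤ 1) :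
    ∃ v : Fin m → ℂ, ∀ k, ∃ c : ℂ, c • v = V ω k *ᵥ x := by
  rw [instAct_vecMulVec, Matrix.rank_self_mul_conjTranspose,
    Matrix.rank_eq_finrank_span_cols] at h
  obtain ⟨v, hv⟩ := finrank_le_one_iff.1 h
  refine ⟨v, fun k => ?_⟩
  obtain ⟨c, hc⟩ := hv ⟨_, Submodule.subset_span (Set.mem_range_self k)⟩
  exact ⟨c, congrArg Subtype.val hc⟩

theorem rank_instAct_le_rank_post {ρ : Matrix (Fin n) (Fin n) ℂ} (hρ : ρ.PosSemidef) (ω : Ω) :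
    (instAct V ω ρ).rank ≤ (post V ω ρ).rank := by
  have h : instAct V ω ρ
      = ((instAct V ω ρ).trace.re • (1 : Matrix (Fin m) (Fin m) ℂ)) * post V ω ρ := by
    rcases (instAct_trace_re_nonneg V hρ ω).eq_or_lt with h0 | h0
    · have : instAct V ω ρ = 0 := (instAct_posSemidef V hρ ω).trace_eq_zero_iff.1 (by
        rw [instAct_trace_eq_ofReal V hρ ω, ← h0, Complex.ofReal_zero])
      simp [this]
    · rw [post, Matrix.smul_mul, Matrix.one_mul, smul_smul, mul_inv_cancel₀ h0.ne', one_smul]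
  calc _ = _ := congrArg Matrix.rank h
    _ ≤ _ := Matrix.rank_mul_le_right _ _

theorem exists_line_of_pure {ω : Ω}
    (h : ∀ x : Fin n → ℂ, star x ⬝ᵥ x = 1 →
      0 < (instAct V ω (vecMulVec x (star x))).trace.re →
      (post V ω (vecMulVec x (star x))).rank = 1) (x : Fin n → ℂ) :
    ∃ v : Fin m → ℂ, ∀ k, ∃ c : ℂ, c • v = V ω k *ᵥ x := by
  by_cases hx : x = 0
  · exact ⟨0, fun k => ⟨0, by simp [hx]⟩⟩
  have hpos : 0 < star x ⬝ᵥ x := Matrix.dotProduct_star_self_pos_iff.2 hx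
  obtain ⟨hre, him⟩ := Complex.lt_def.1 hpos
  set r : ℝ := √(star x ⬝ᵥ x).re with hr
  have hr0 : (r : ℂ) ≠ 0 := by exact_mod_cast (Real.sqrt_pos.2 hre).ne'
  have hrr : star x ⬝ᵥ x = (r : ℂ) * r := by
    rw [← Complex.ofReal_mul, hr, Real.mul_self_sqrt hre.le]
    exact Complex.ext rfl him.symm
  set u : Fin n → ℂ := (r : ℂ)⁻¹ • x with hu
  have hu1 : star u ⬝ᵥ u = 1 := by
    rw [hu, star_smul, smul_dotProduct, dotProduct_smul, hrr]
    simp [hr0]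
  have hd := isDensityMatrix_vecMulVec hu1
  have hrank : (instAct V ω (vecMulVec u (star u))).rank ≤ 1 := by
    rcases (instAct_trace_re_nonneg V hd.1 ω).eq_or_lt with h0 | h0
    · have : instAct V ω (vecMulVec u (star u)) = 0 :=
        (instAct_posSemidef V hd.1 ω).trace_eq_zero_iff.1 (by
          rw [instAct_trace_eq_ofReal V hd.1 ω, ← h0, Complex.ofReal_zero])
      simp [this]
    · exact (rank_instAct_le_rank_post V hd.1 ω).trans (h u hu1 h0).le
  obtain ⟨v, hv⟩ := exists_line_of_rank_le_one V hrank
  refine ⟨v, fun k => ?_⟩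
  obtain ⟨c, hc⟩ := hv k
  refine ⟨r * c, ?_⟩
  rw [mul_smul, hc, ← Matrix.mulVec_smul, hu, smul_smul, mul_inv_cancel₀ hr0, one_smul]

/-- The Kraus operators of a purity-preserving outcome are either all multiples of one of them,
or all of the form `v * c k` for a fixed column `v`. -/
theorem kraus_eq_smul_or_eq_vecMulVec {κ : Type*} (W : κ → Matrix (Fin m) (Fin n) ℂ)
    (h : ∀ x : Fin n → ℂ, ∃ v : Fin m → ℂ, ∀ k, ∃ c : ℂ, c • v = W k *ᵥ x) :
    (∃ k₀, ∃ c : κ → ℂ, ∀ k, W k = c k • W k₀) ∨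
      ∃ v : Fin m → ℂ, ∃ c : κ → Fin n → ℂ, ∀ k, W k = vecMulVec v (c k) := by
  rcases LinearMap.forall_eq_smul_or_forall_mem_line (fun k => (W k).mulVecLin) h with
    ⟨k₀, c, hc⟩ | ⟨v, hv⟩
  · refine Or.inl ⟨k₀, c, fun k => Matrix.ext_of_mulVec_single fun i => ?_⟩
    rw [Matrix.smul_mulVec]
    exact LinearMap.congr_fun (hc k) (Pi.single i 1)
  · choose c hc using hv
    refine Or.inr ⟨v, fun k j => c k (Pi.single j 1), fun k => ?_⟩
    ext i j
    have := congrFun (hc k (Pi.single j 1)) i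
    simp only [Pi.smul_apply, smul_eq_mul, Matrix.mulVecLin_apply, Matrix.mulVec_single_one,
      Matrix.col_apply] at this
    rw [← this, Matrix.vecMulVec_apply, mul_comm]

theorem conj_povm_posSemidef (B : Matrix (Fin n) (Fin n) ℂ) (ω : Ω) :
    (B * povm V ω * Bᴴ).PosSemidef :=
  (Matrix.posSemidef_sum _ fun k _ =>
    Matrix.posSemidef_conjTranspose_mul_self (V ω k)).mul_mul_conjTranspose_same B

theorem trace_conj_povm (B : Matrix (Fin n) (Fin n) ℂ) (ω : Ω) :
    (B * povm V ω * Bᴴ).trace = (instAct V ω (Bᴴ * B)).trace := by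
  simp only [povm, instAct, Matrix.mul_sum, Matrix.sum_mul, Matrix.trace_sum]
  refine Finset.sum_congr rfl fun k _ => ?_
  rw [Matrix.trace_mul_cycle, ← Matrix.mul_assoc, Matrix.trace_mul_comm]
  simp only [Matrix.mul_assoc]

/-- For a purity-preserving outcome, the a posteriori state has no more entropy than the
corresponding normalized component of the decomposition `B * Bᴴ = ∑ ω, B * povm V ω * Bᴴ`. -/
theorem vnEntropy_post_le (B : Matrix (Fin n) (Fin n) ℂ) {ω : Ω}
    (hω : 0 < (instAct V ω (Bᴴ * B)).trace.re)
    (h : ∀ x : Fin n → ℂ, ∃ v : Fin m → ℂ, ∀ k, ∃ c : ℂ, c • v = V ω k *ᵥ x) :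
    vnEntropy (post V ω (Bᴴ * B)) ≤
      vnEntropy ((instAct V ω (Bᴴ * B)).trace.re⁻¹ • (B * povm V ω * Bᴴ)) := by
  have hpost := post_isDensityMatrix V (Matrix.posSemidef_conjTranspose_mul_self B) hω
  set p := (instAct V ω (Bᴴ * B)).trace.re with hp
  have hA := conj_povm_posSemidef V B ω
  have hσ : IsDensityMatrix (p⁻¹ • (B * povm V ω * Bᴴ)) := by
    refine ⟨hA.smul (inv_nonneg.2 hω.le), ?_⟩
    rw [Matrix.trace_smul, trace_conj_povm, ← Matrix.trace_smul]
    exact hpost.2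
  rcases kraus_eq_smul_or_eq_vecMulVec (V ω) h with ⟨k₀, c, hc⟩ | ⟨v, c, hc⟩
  · set W := V ω k₀
    set s : ℂ := ∑ k, c k * star (c k)
    have h1 : post V ω (Bᴴ * B) = (W * Bᴴ) * (p⁻¹ • s • (B * Wᴴ)) := by
      rw [post, ← hp, Matrix.mul_smul, Matrix.mul_smul, instAct, Finset.sum_smul]
      congr 1
      refine Finset.sum_congr rfl fun k _ => ?_
      rw [hc k, Matrix.conjTranspose_smul, Matrix.mul_smul, Matrix.smul_mul, Matrix.smul_mul,
        smul_smul, mul_comm (c k)]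
      simp only [Matrix.mul_assoc]
    have h2 : p⁻¹ • (B * povm V ω * Bᴴ) = (p⁻¹ • s • (B * Wᴴ)) * (W * Bᴴ) := by
      rw [Matrix.smul_mul, Matrix.smul_mul, povm, Finset.sum_smul, Matrix.mul_sum, Matrix.sum_mul]
      congr 1
      refine Finset.sum_congr rfl fun k _ => ?_
      rw [hc k, Matrix.conjTranspose_smul, Matrix.mul_smul, Matrix.smul_mul, smul_smul,
        Matrix.mul_smul, Matrix.smul_mul]
      simp only [Matrix.mul_assoc]
    have h1' := hpost.1.1
    have h2' := hσ.1.1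
    rw [h1] at h1' ⊢
    rw [h2] at h2' ⊢
    exact (vnEntropy_mul_comm _ _ h1' h2').le
  · have h1 : post V ω (Bᴴ * B)
        = vecMulVec v (p⁻¹ • ∑ k, (c k ᵥ* (Bᴴ * B)) ᵥ* (V ω k)ᴴ) := by
      rw [post, ← hp, Matrix.vecMulVec_smul, instAct]
      congr 1
      ext i j
      simp only [Matrix.sum_apply, Matrix.vecMulVec_apply, Finset.sum_apply, Finset.mul_sum]
      refine Finset.sum_congr rfl fun k _ => ?_
      conv_lhs => rw [hc k, Matrix.vecMulVec_mul, Matrix.vecMulVec_mul, ← hc k]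
      rfl
    have h0 : vnEntropy (post V ω (Bᴴ * B)) = 0 :=
      hpost.vnEntropy_eq_zero_iff.2 (hpost.rank_eq_one_of_le (by
        rw [h1]; exact Matrix.rank_vecMulVec_le _ _))
    rw [h0]
    exact hσ.vnEntropy_nonneg

open scoped MatrixOrder in
theorem infoGain_nonneg_of_forall_line [Fintype Ω] (hV : ∑ ω, ∑ k, (V ω k)ᴴ * V ω k = 1)
    (h : ∀ ω, ∀ x : Fin n → ℂ, ∃ v : Fin m → ℂ, ∀ k, ∃ c : ℂ, c • v = V ω k *ᵥ x)
    {ρ : Matrix (Fin n) (Fin n) ℂ} (hρ : IsDensityMatrix ρ) : 0 ≤ infoGain V ρ := by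
  obtain ⟨B, rfl⟩ : ∃ B : Matrix (Fin n) (Fin n) ℂ, ρ = Bᴴ * B :=
    CStarAlgebra.nonneg_iff_eq_star_mul_self.1 hρ.1.nonneg
  set p : Ω → ℝ := fun ω => (instAct V ω (Bᴴ * B)).trace.re with hp
  set A : Ω → Matrix (Fin n) (Fin n) ℂ := fun ω => B * povm V ω * Bᴴ with hA
  have hp0 (ω : Ω) : 0 ≤ p ω := instAct_trace_re_nonneg V hρ.1 ω
  have hAsum : ∑ ω, A ω = B * Bᴴ := by
    rw [hA, ← Matrix.sum_mul, ← Matrix.mul_sum]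
    simp only [povm, hV, Matrix.mul_one]
  have hpA (ω : Ω) : (A ω).trace = (p ω : ℂ) := by
    rw [hA, trace_conj_povm, instAct_trace_eq_ofReal V hρ.1]
  have hpsum : ∑ ω, p ω = 1 := by
    have : ((∑ ω, p ω : ℝ) : ℂ) = 1 := by
      rw [Complex.ofReal_sum]
      simp_rw [← hpA]
      rw [← Matrix.trace_sum, hAsum, Matrix.trace_mul_comm, hρ.2]
    exact_mod_cast this
  have hAp (ω : Ω) : p ω • (p ω)⁻¹ • A ω = A ω := by
    rcases (hp0 ω).eq_or_lt with h0 | h0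
    · have : A ω = 0 := (conj_povm_posSemidef V B ω).trace_eq_zero_iff.1 (by
        rw [hpA ω, ← h0, Complex.ofReal_zero])
      simp [this]
    · rw [smul_smul, mul_inv_cancel₀ h0.ne', one_smul]
  have hconc := sum_smul_vnEntropy_le p hp0 hpsum (fun ω => (p ω)⁻¹ • A ω)
    fun ω => (conj_povm_posSemidef V B ω).smul (inv_nonneg.2 (hp0 ω))
  simp only [hAp, hAsum] at hconc
  rw [vnEntropy_mul_comm B Bᴴ (Matrix.isHermitian_mul_conjTranspose_self B) hρ.1.1] at hconc
  refine sub_nonneg.2 (le_trans (Finset.sum_le_sum fun ω _ => ?_) hconc)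
  split_ifs with hω
  · exact mul_le_mul_of_nonneg_left (vnEntropy_post_le V B hω (h ω)) hω.le
  · have : p ω = 0 := le_antisymm (not_lt.1 hω) (hp0 ω)
    rw [this, zero_mul]

theorem rank_post_eq_one_of_infoGain_nonneg [Fintype Ω] {x : Fin n → ℂ} (hx : star x ⬝ᵥ x = 1)
    (h : 0 ≤ infoGain V (vecMulVec x (star x))) {ω : Ω}
    (hω : 0 < (instAct V ω (vecMulVec x (star x))).trace.re) :
    (post V ω (vecMulVec x (star x))).rank = 1 := by
  have hd := (isDensityMatrix_vecMulVec hx).1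
  rw [infoGain, vnEntropy_vecMulVec hx, zero_sub, neg_nonneg] at h
  have hnn (ω' : Ω) : 0 ≤ if 0 < (instAct V ω' (vecMulVec x (star x))).trace.re then
      (instAct V ω' (vecMulVec x (star x))).trace.re * vnEntropy (post V ω' (vecMulVec x (star x)))
      else 0 := by
    split_ifs with h'
    · exact mul_nonneg h'.le (post_isDensityMatrix V hd h').vnEntropy_nonneg
    · exact le_rfl
  have h0 := (Finset.sum_eq_zero_iff_of_nonneg fun ω' _ => hnn ω').1
    (le_antisymm h (Finset.sum_nonneg fun ω' _ => hnn ω')) ω (Finset.mem_univ ω)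
  rw [if_pos hω] at h0
  exact (post_isDensityMatrix V hd hω).vnEntropy_eq_zero_iff.1
    ((mul_eq_zero.1 h0).resolve_left hω.ne')

end Instrument

theorem groenewold_lindblad_ozawa {Ω K : Type*} [Fintype Ω] [Fintype K]
    [Nonempty Ω] [Nonempty K] {n m : ℕ} (hn : 1 ≤ n) (hm : 1 ≤ m)
    (V : Ω → K → Matrix (Fin m) (Fin n) ℂ)
    (hV : ∑ ω, ∑ k, (V ω k)ᴴ * V ω k = 1) :
    (∀ x : Fin n → ℂ, star x ⬝ᵥ x = 1 → ∀ ω : Ω,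
        0 < (instAct V ω (vecMulVec x (star x))).trace.re →
        (post V ω (vecMulVec x (star x))).rank = 1)
      ↔ (∀ ρ : Matrix (Fin n) (Fin n) ℂ, IsDensityMatrix ρ → 0 ≤ infoGain V ρ) := by
  exact ⟨fun h _ hρ => infoGain_nonneg_of_forall_line V hV
      (fun ω => exists_line_of_pure V fun x hx => h x hx ω) hρ,
    fun h _ hx _ hω => rank_post_eq_one_of_infoGain_nonneg V hx
      (h _ (isDensityMatrix_vecMulVec hx)) hω⟩

end
end

section
/- Strengthened Scutaru lower bound via compound states (eq. (3.60), first inequality): I_c ≥ χ{P_f, ε_{if}}, where for each ω with P_f(ω) > 0 the compound state is ε_{if}(ω) := Σ_{α : p(α,ω) > 0} P_{i|f}(α|ω)·(ρ_α ⊗ η_f^α), a density matrix on ℂ^n ⊗ ℂ^m, and χ{P_f, ε_{if}} is the χ-quantity of the ensemble (P_f(ω), ε_{if}(ω))_{ω : P_f(ω) > 0}, whose barycenter is η_{if} := Σ_{α : p_α > 0} p_α·(ρ_α ⊗ η_f^α). -/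
open Matrix BigOperators
open scoped Kronecker ComplexOrder

noncomputable section

namespace Matrix.IsHermitian

variable {ι : Type*} [Fintype ι] [DecidableEq ι] {A B : Matrix ι ι ℂ}

/-- The matrix obtained by applying `f` to the eigenvalues of a Hermitian matrix. -/
def spectralMap (hA : A.IsHermitian) (f : ℝ → ℝ) : Matrix ι ι ℂ :=
  (hA.eigenvectorUnitary : Matrix ι ι ℂ) * diagonal (fun i => (f (hA.eigenvalues i) : ℂ)) *
    (hA.eigenvectorUnitary : Matrix ι ι ℂ)ᴴ

/-- The squared overlap of the `i`-th eigenvector of `A` and the `j`-th eigenvector of `B`. -/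
def overlap (hA : A.IsHermitian) (hB : B.IsHermitian) (i j : ι) : ℝ :=
  Complex.normSq (((hA.eigenvectorUnitary : Matrix ι ι ℂ)ᴴ *
    (hB.eigenvectorUnitary : Matrix ι ι ℂ)) i j)

lemma overlap_nonneg (hA : A.IsHermitian) (hB : B.IsHermitian) (i j : ι) :
    0 ≤ hA.overlap hB i j := Complex.normSq_nonneg _

lemma conjTranspose_mul_eigenvectorUnitary (hA : A.IsHermitian) :
    (hA.eigenvectorUnitary : Matrix ι ι ℂ)ᴴ * (hA.eigenvectorUnitary : Matrix ι ι ℂ) = 1 :=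
  Unitary.coe_star_mul_self hA.eigenvectorUnitary

lemma eigenvectorUnitary_mul_conjTranspose (hA : A.IsHermitian) :
    (hA.eigenvectorUnitary : Matrix ι ι ℂ) * (hA.eigenvectorUnitary : Matrix ι ι ℂ)ᴴ = 1 :=
  Unitary.coe_mul_star_self hA.eigenvectorUnitary

lemma spectralMap_mul (hA : A.IsHermitian) (f g : ℝ → ℝ) :
    hA.spectralMap f * hA.spectralMap g = hA.spectralMap (fun x => f x * g x) := by
  simp only [spectralMap]
  set U := (hA.eigenvectorUnitary : Matrix ι ι ℂ)
  have hU : Uᴴ * U = 1 := hA.conjTranspose_mul_eigenvectorUnitary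
  calc _ = U * (diagonal (fun i => (f (hA.eigenvalues i) : ℂ)) * (Uᴴ * U) *
        diagonal (fun i => (g (hA.eigenvalues i) : ℂ))) * Uᴴ := by simp only [Matrix.mul_assoc]
    _ = _ := by rw [hU, Matrix.mul_one, diagonal_mul_diagonal]; simp

lemma spectralMap_id (hA : A.IsHermitian) : hA.spectralMap (fun x => x) = A := by
  conv_rhs => rw [hA.spectral_theorem, Unitary.conjStarAlgAut_apply]
  rfl

lemma spectralMap_one (hA : A.IsHermitian) : hA.spectralMap (fun _ => 1) = 1 := by
  simp [spectralMap, eigenvectorUnitary_mul_conjTranspose]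

lemma spectralMap_sub (hA : A.IsHermitian) (f g : ℝ → ℝ) :
    hA.spectralMap f - hA.spectralMap g = hA.spectralMap (fun x => f x - g x) := by
  simp only [spectralMap, ← Matrix.sub_mul, ← Matrix.mul_sub, diagonal_sub]
  simp

lemma spectralMap_posSemidef (hA : A.IsHermitian) {f : ℝ → ℝ}
    (hf : ∀ i, 0 ≤ f (hA.eigenvalues i)) : (hA.spectralMap f).PosSemidef := by
  refine PosSemidef.mul_mul_conjTranspose_same (PosSemidef.diagonal ?_) _
  intro i
  simpa using hf i

lemma spectralMap_isHermitian (hA : A.IsHermitian) (f : ℝ → ℝ) :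
    (hA.spectralMap f).IsHermitian := by
  refine isHermitian_mul_mul_conjTranspose _ (isHermitian_diagonal_iff.2 fun i => ?_)
  simp [IsSelfAdjoint]

lemma trace_spectralMap_mul (hA : A.IsHermitian) (hB : B.IsHermitian) (f g : ℝ → ℝ) :
    (hA.spectralMap f * hB.spectralMap g).trace.re =
      ∑ i, ∑ j, hA.overlap hB i j * (f (hA.eigenvalues i) * g (hB.eigenvalues j)) := by
  simp only [spectralMap, overlap]
  set U := (hA.eigenvectorUnitary : Matrix ι ι ℂ)
  set V := (hB.eigenvectorUnitary : Matrix ι ι ℂ)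
  have h : (U * diagonal (fun i => (f (hA.eigenvalues i) : ℂ)) * Uᴴ *
      (V * diagonal (fun i => (g (hB.eigenvalues i) : ℂ)) * Vᴴ)).trace =
      (diagonal (fun i => (f (hA.eigenvalues i) : ℂ)) * (Uᴴ * V) *
        diagonal (fun i => (g (hB.eigenvalues i) : ℂ)) * (Uᴴ * V)ᴴ).trace := by
    rw [Matrix.mul_assoc U, Matrix.mul_assoc U, Matrix.trace_mul_comm U]
    simp only [Matrix.mul_assoc, conjTranspose_mul, conjTranspose_conjTranspose]
  rw [h]
  simp only [trace, diag_apply, Complex.re_sum]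
  refine Finset.sum_congr rfl fun i _ => ?_
  rw [Matrix.mul_apply, Complex.re_sum]
  refine Finset.sum_congr rfl fun j _ => ?_
  rw [mul_diagonal, diagonal_mul, conjTranspose_apply]
  have : ∀ z : ℂ, ∀ a b : ℝ, ((a : ℂ) * z * b * star z).re = Complex.normSq z * (a * b) := by
    intro z a b
    simp [Complex.normSq_apply]
    ring
  exact this _ _ _

lemma trace_spectralMap (hA : A.IsHermitian) (f : ℝ → ℝ) :
    (hA.spectralMap f).trace.re = ∑ i, f (hA.eigenvalues i) := by
  rw [spectralMap, Matrix.trace_mul_comm, ← Matrix.mul_assoc,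
    conjTranspose_mul_eigenvectorUnitary, Matrix.one_mul]
  simp [trace]

end Matrix.IsHermitian

lemma sub_mul_log_sub_log_le {u v : ℝ} (hu : 0 < u) (hv : 0 < v) :
    (u - v) * (Real.log u - Real.log v) ≤ 1 / 2 * (u - v) ^ 2 * (1 / u + 1 / v) := by
  have key : ∀ u v : ℝ, 0 < u → 0 < v → v ≤ u →
      (u - v) * (Real.log u - Real.log v) ≤ 1 / 2 * (u - v) ^ 2 * (1 / u + 1 / v) := by
    intro u v hu hv h
    have h1 : Real.log (u / v) ≤ Real.sinh (Real.log (u / v)) :=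
      Real.self_le_sinh_iff.2 (Real.log_nonneg ((one_le_div hv).2 h))
    rw [Real.sinh_log (by positivity), Real.log_div hu.ne' hv.ne'] at h1
    calc _ ≤ (u - v) * ((u / v - (u / v)⁻¹) / 2) :=
          mul_le_mul_of_nonneg_left h1 (sub_nonneg.2 h)
      _ = _ := by field_simp; ring
  rcases le_total v u with h | h
  · exact key u v hu hv h
  · have := key v u hv hu h
    calc _ = (v - u) * (Real.log v - Real.log u) := by ring
      _ ≤ _ := this
      _ = _ := by ring

lemma half_sq_mul_le_sub_mul_log_sub_log {a b : ℝ} (ha : 0 < a) (hb : 0 < b) :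
    1 / 2 * (b - a) ^ 2 * (1 / a + 1 / b) ≤
      (b - a) * (Real.log b - Real.log a) + |b - a| ^ 3 / (2 * (a * b)) := by
  have key : ∀ a b : ℝ, 0 < a → 0 < b → a ≤ b → 1 / 2 * (b - a) ^ 2 * (1 / a + 1 / b) ≤
      (b - a) * (Real.log b - Real.log a) + (b - a) ^ 3 / (2 * (a * b)) := by
    intro a b ha hb h
    have h1 := Real.one_sub_inv_le_log_of_pos (div_pos hb ha)
    rw [Real.log_div hb.ne' ha.ne'] at h1
    have h2 := mul_le_mul_of_nonneg_left h1 (sub_nonneg.2 h)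
    have h3 : 1 / 2 * (b - a) ^ 2 * (1 / a + 1 / b) =
        (b - a) * (1 - (b / a)⁻¹) + (b - a) ^ 3 / (2 * (a * b)) := by field_simp; ring
    linarith
  rcases le_total a b with h | h
  · rw [abs_of_nonneg (sub_nonneg.2 h)]
    exact key a b ha hb h
  · rw [abs_of_nonpos (sub_nonpos.2 h), neg_sub, mul_comm a b]
    have := key b a hb ha h
    calc _ = 1 / 2 * (a - b) ^ 2 * (1 / b + 1 / a) := by ring
      _ ≤ _ := this
      _ = _ := by ring

lemma le_of_forall_sub_le_mul_sq {F : ℝ → ℝ} {C T : ℝ} (hT : 0 ≤ T)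
    (h : ∀ s t, 0 ≤ s → s < t → t ≤ T → F t - F s ≤ C * (t - s) ^ 2) : F T ≤ F 0 := by
  rcases hT.eq_or_lt with rfl | hT
  · exact le_rfl
  have hN : ∀ N : ℕ, F T - F 0 ≤ C * T ^ 2 * (1 / ((N : ℝ) + 1)) := by
    intro N
    have hN0 : (0 : ℝ) < (N : ℝ) + 1 := by positivity
    have h1 : ∀ k ∈ Finset.range (N + 1), F (T * ((k + 1 : ℕ) : ℝ) / (N + 1)) -
        F (T * (k : ℝ) / (N + 1)) ≤ C * (T / (N + 1)) ^ 2 := by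
      intro k hk
      have hk' : ((k + 1 : ℕ) : ℝ) ≤ N + 1 := by
        exact_mod_cast Finset.mem_range.1 hk
      refine (h _ _ (by positivity) ?_ ?_).trans_eq ?_
      · push_cast
        gcongr
        linarith
      · rw [div_le_iff₀ hN0]
        gcongr
      · push_cast
        congr 2
        field_simp
        ring
    have h2 := Finset.sum_le_sum h1
    rw [Finset.sum_range_sub (fun k : ℕ => F (T * (k : ℝ) / (N + 1)))] at h2
    simp only [Finset.sum_const, Finset.card_range, nsmul_eq_mul] at h2
    push_cast at h2
    rw [mul_div_cancel_right₀ _ hN0.ne'] at h2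
    simp only [mul_zero, zero_div] at h2
    refine h2.trans_eq ?_
    field_simp
  have hlim : Filter.Tendsto (fun N : ℕ => C * T ^ 2 * (1 / ((N : ℝ) + 1))) Filter.atTop
      (nhds (C * T ^ 2 * 0)) := tendsto_one_div_add_atTop_nhds_zero_nat.const_mul _
  have := ge_of_tendsto' hlim hN
  linarith

namespace Matrix.IsHermitian

variable {ι : Type*} [Fintype ι] [DecidableEq ι] {A B : Matrix ι ι ℂ}

lemma overlap_comm (hA : A.IsHermitian) (hB : B.IsHermitian) (i j : ι) :
    hA.overlap hB i j = hB.overlap hA j i := by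
  rw [overlap, overlap, ← Complex.normSq_conj]
  congr 1
  have : (hB.eigenvectorUnitary : Matrix ι ι ℂ)ᴴ * (hA.eigenvectorUnitary : Matrix ι ι ℂ) =
    ((hA.eigenvectorUnitary : Matrix ι ι ℂ)ᴴ * (hB.eigenvectorUnitary : Matrix ι ι ℂ))ᴴ := by
    simp
  rw [this]
  rfl

lemma trace_sub_mul_spectralMap_sub (hA : A.IsHermitian) (hB : B.IsHermitian) (f : ℝ → ℝ) :
    ((A - B) * (hA.spectralMap f - hB.spectralMap f)).trace.re =
      ∑ i, ∑ j, hA.overlap hB i j * ((hA.eigenvalues i - hB.eigenvalues j) *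
        (f (hA.eigenvalues i) - f (hB.eigenvalues j))) := by
  have h : ((A - B) * (hA.spectralMap f - hB.spectralMap f)).trace =
      (hA.spectralMap (fun x => x * f x) * hB.spectralMap (fun _ => 1)).trace
      - (hA.spectralMap (fun x => x) * hB.spectralMap f).trace
      - (hA.spectralMap f * hB.spectralMap (fun x => x)).trace
      + (hA.spectralMap (fun _ => 1) * hB.spectralMap (fun x => x * f x)).trace := by
    rw [← spectralMap_mul, ← spectralMap_mul, spectralMap_id, spectralMap_id, spectralMap_one,
      spectralMap_one, Matrix.mul_one, Matrix.one_mul, Matrix.trace_mul_comm (hA.spectralMap f) B]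
    simp only [Matrix.sub_mul, Matrix.mul_sub, trace_sub]
    ring
  rw [h]
  simp only [Complex.add_re, Complex.sub_re, trace_spectralMap_mul, ← Finset.sum_sub_distrib,
    ← Finset.sum_add_distrib]
  exact Finset.sum_congr rfl fun i _ => Finset.sum_congr rfl fun j _ => by ring

lemma trace_sub_mul_spectralMap_mul_sub (hA : A.IsHermitian) (hB : B.IsHermitian) (k : ℝ → ℝ) :
    ((A - B) * hA.spectralMap k * (A - B)).trace.re =
      ∑ i, ∑ j, hA.overlap hB i j *
        ((hA.eigenvalues i - hB.eigenvalues j) ^ 2 * k (hA.eigenvalues i)) := by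
  have h : ((A - B) * hA.spectralMap k * (A - B)).trace =
      (hA.spectralMap (fun x => x * k x * x) * hB.spectralMap (fun _ => 1)).trace
      - (hA.spectralMap (fun x => x * k x) * hB.spectralMap (fun x => x)).trace
      - (hA.spectralMap (fun x => k x * x) * hB.spectralMap (fun x => x)).trace
      + (hA.spectralMap k * hB.spectralMap (fun x => x * x)).trace := by
    simp only [← spectralMap_mul, spectralMap_id, spectralMap_one, Matrix.mul_one]
    have e1 : (B * hA.spectralMap k * A).trace = (hA.spectralMap k * A * B).trace := by
      rw [Matrix.mul_assoc, Matrix.trace_mul_comm]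
    have e2 : (B * hA.spectralMap k * B).trace = (hA.spectralMap k * (B * B)).trace := by
      rw [Matrix.mul_assoc, Matrix.trace_mul_comm, Matrix.mul_assoc]
    simp only [Matrix.sub_mul, Matrix.mul_sub, trace_sub, e1, e2]
    ring
  rw [h]
  simp only [Complex.add_re, Complex.sub_re, trace_spectralMap_mul, ← Finset.sum_sub_distrib,
    ← Finset.sum_add_distrib]
  exact Finset.sum_congr rfl fun i _ => Finset.sum_congr rfl fun j _ => by ring

lemma trace_sub_mul_log_sub_le (hA : A.PosSemidef) (hB : B.PosSemidef) {ε : ℝ} (hε : 0 < ε) :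
    ((A - B) * (hA.1.spectralMap (fun x => Real.log (x + ε)) -
      hB.1.spectralMap (fun x => Real.log (x + ε)))).trace.re ≤
    1 / 2 * (((A - B) * hA.1.spectralMap (fun x => 1 / (x + ε)) * (A - B)).trace.re +
      ((A - B) * hB.1.spectralMap (fun x => 1 / (x + ε)) * (A - B)).trace.re) := by
  have hswap : ((A - B) * hB.1.spectralMap (fun x => 1 / (x + ε)) * (A - B)) =
      ((B - A) * hB.1.spectralMap (fun x => 1 / (x + ε)) * (B - A)) := by
    rw [← neg_sub B A, Matrix.neg_mul, Matrix.neg_mul, Matrix.mul_neg, neg_neg]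
  rw [hswap, trace_sub_mul_spectralMap_sub, trace_sub_mul_spectralMap_mul_sub hA.1 hB.1,
    trace_sub_mul_spectralMap_mul_sub hB.1 hA.1, Finset.sum_comm (γ := ι) (α := ι)
    (f := fun i j => hB.1.overlap hA.1 i j * _), ← Finset.sum_add_distrib, Finset.mul_sum]
  refine Finset.sum_le_sum fun i _ => ?_
  rw [← Finset.sum_add_distrib, Finset.mul_sum]
  refine Finset.sum_le_sum fun j _ => ?_
  rw [hB.1.overlap_comm hA.1 j i]
  have h1 := hA.eigenvalues_nonneg i
  have h2 := hB.eigenvalues_nonneg j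
  have h3 := mul_le_mul_of_nonneg_left (sub_mul_log_sub_log_le (add_pos_of_nonneg_of_pos h1 hε)
    (add_pos_of_nonneg_of_pos h2 hε)) (hA.1.overlap_nonneg hB.1 i j)
  rw [add_sub_add_right_eq_sub] at h3
  refine h3.trans_eq ?_
  ring

/-- A regularised relative entropy is bounded by a quadratic expression. -/
lemma trace_add_mul_log_sub_le (hA : A.PosSemidef) (hB : B.PosSemidef) {ε : ℝ} (hε : 0 < ε) :
    ((A + (ε : ℂ) • 1) * (hA.1.spectralMap (fun x => Real.log (x + ε)) -
      hB.1.spectralMap (fun x => Real.log (x + ε)))).trace.re ≤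
    (A - B).trace.re + 1 / ε * ((A - B) * (A - B)).trace.re := by
  have hid : A + (ε : ℂ) • 1 = hA.1.spectralMap (fun x => x + ε) := by
    have : A + (ε : ℂ) • (1 : Matrix ι ι ℂ) =
        hA.1.spectralMap (fun x => x) - hA.1.spectralMap (fun _ => -ε) := by
      rw [spectralMap_id, sub_eq_add_neg]
      congr 1
      rw [spectralMap]
      have : (diagonal fun _ => ((-ε : ℝ) : ℂ)) = (-(ε : ℂ)) • (1 : Matrix ι ι ℂ) := by
        ext i j
        by_cases h : i = j <;> simp [diagonal, h]
      rw [this, Matrix.mul_smul, Matrix.mul_one, Matrix.smul_mul,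
        eigenvectorUnitary_mul_conjTranspose, neg_smul, neg_neg]
    rw [this, spectralMap_sub]
    simp
  have h1 : ((A + (ε : ℂ) • 1) * (hA.1.spectralMap (fun x => Real.log (x + ε)) -
      hB.1.spectralMap (fun x => Real.log (x + ε)))).trace.re =
      ∑ i, ∑ j, hA.1.overlap hB.1 i j * ((hA.1.eigenvalues i + ε) *
        (Real.log (hA.1.eigenvalues i + ε) - Real.log (hB.1.eigenvalues j + ε))) := by
    have : ((A + (ε : ℂ) • 1) * (hA.1.spectralMap (fun x => Real.log (x + ε)) -
      hB.1.spectralMap (fun x => Real.log (x + ε)))) =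
      hA.1.spectralMap (fun x => (x + ε) * Real.log (x + ε)) * hB.1.spectralMap (fun _ => 1) -
      hA.1.spectralMap (fun x => x + ε) * hB.1.spectralMap (fun x => Real.log (x + ε)) := by
      rw [hid, Matrix.mul_sub, spectralMap_mul, spectralMap_one, Matrix.mul_one]
    rw [this]
    simp only [trace_sub, Complex.sub_re, trace_spectralMap_mul, ← Finset.sum_sub_distrib]
    exact Finset.sum_congr rfl fun i _ => Finset.sum_congr rfl fun j _ => by ring
  have h2 : ((A - B) * (A - B)).trace.re = ∑ i, ∑ j, hA.1.overlap hB.1 i j *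
      ((hA.1.eigenvalues i - hB.1.eigenvalues j) ^ 2 * 1) := by
    rw [← trace_sub_mul_spectralMap_mul_sub hA.1 hB.1 (fun _ => 1), spectralMap_one,
      Matrix.mul_one]
  have h3 : (A - B).trace.re = ∑ i, ∑ j, hA.1.overlap hB.1 i j *
      (hA.1.eigenvalues i - hB.1.eigenvalues j) := by
    have : A - B = hA.1.spectralMap (fun x => x) * hB.1.spectralMap (fun _ => 1) -
        hA.1.spectralMap (fun _ => 1) * hB.1.spectralMap (fun x => x) := by
      simp [spectralMap_one, spectralMap_id]
    rw [this]
    simp only [trace_sub, Complex.sub_re, trace_spectralMap_mul, ← Finset.sum_sub_distrib]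
    exact Finset.sum_congr rfl fun i _ => Finset.sum_congr rfl fun j _ => by ring
  rw [h1, h2, h3, Finset.mul_sum, ← Finset.sum_add_distrib]
  refine Finset.sum_le_sum fun i _ => ?_
  rw [Finset.mul_sum, ← Finset.sum_add_distrib]
  refine Finset.sum_le_sum fun j _ => ?_
  have ha := hA.eigenvalues_nonneg i
  have hb := hB.eigenvalues_nonneg j
  have hw := hA.1.overlap_nonneg hB.1 i j
  set a := hA.1.eigenvalues i
  set b := hB.1.eigenvalues j
  have hu : 0 < a + ε := by positivity
  have hv : 0 < b + ε := by positivity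
  have hlog : Real.log (a + ε) - Real.log (b + ε) ≤ (a - b) / (b + ε) := by
    rw [← Real.log_div hu.ne' hv.ne']
    refine (Real.log_le_sub_one_of_pos (by positivity)).trans_eq ?_
    field_simp
    ring
  have hquad : (a + ε) * (Real.log (a + ε) - Real.log (b + ε)) ≤ (a - b) + 1 / ε * (a - b) ^ 2 := by
    calc _ ≤ (a + ε) * ((a - b) / (b + ε)) := mul_le_mul_of_nonneg_left hlog hu.le
      _ = (a - b) + 1 / (b + ε) * (a - b) ^ 2 := by field_simp; ring
      _ ≤ _ := by
        gcongr
        linarith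
  refine (mul_le_mul_of_nonneg_left hquad hw).trans_eq ?_
  ring

end Matrix.IsHermitian

section PreparedStates

variable {ι κ : Type*} [Fintype ι] [DecidableEq ι] [Fintype κ]

lemma trace_mul_spectralMap_mul_le_sum_sq_div {τ : κ → Matrix ι ι ℂ}
    (hτ : ∀ i, IsDensityMatrix (τ i)) {p d : κ → ℝ} (hp : ∀ i, 0 ≤ p i)
    (hd : ∀ i, p i = 0 → d i = 0) {M δ : Matrix ι ι ℂ} (hM : M.PosSemidef)
    (hMp : M = ∑ i, p i • τ i) (hδ : δ = ∑ i, d i • τ i) {ε : ℝ} (hε : 0 < ε) :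
    (δ * hM.1.spectralMap (fun x => 1 / (x + ε)) * δ).trace.re ≤ ∑ i, d i ^ 2 / p i := by
  set K := hM.1.spectralMap (fun x => 1 / (x + ε)) with hK
  have hKH : Kᴴ = K := (hM.1.spectralMap_isHermitian _).eq
  have hδH : δᴴ = δ := by
    rw [hδ, conjTranspose_sum]
    exact Finset.sum_congr rfl fun i _ => by rw [conjTranspose_smul, (hτ i).1.1.eq, star_trivial]
  set Y := K * δ with hY
  have hYH : Yᴴ = δ * K := by rw [hY, conjTranspose_mul, hKH, hδH]
  have hnn : 0 ≤ ∑ i, p i * ((((d i / p i) • (1 : Matrix ι ι ℂ) - Y)ᴴ * τ i *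
      ((d i / p i) • (1 : Matrix ι ι ℂ) - Y)).trace.re) := by
    refine Finset.sum_nonneg fun i _ => mul_nonneg (hp i) ?_
    exact (Complex.nonneg_iff.1 ((hτ i).1.conjTranspose_mul_mul_same _).trace_nonneg).1
  have hterm : ∀ i, p i * ((((d i / p i) • (1 : Matrix ι ι ℂ) - Y)ᴴ * τ i *
      ((d i / p i) • (1 : Matrix ι ι ℂ) - Y)).trace.re) =
      d i ^ 2 / p i - (Yᴴ * (d i • τ i)).trace.re - ((d i • τ i) * Y).trace.re +
        (Yᴴ * (p i • τ i) * Y).trace.re := by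
    intro i
    have e : (((d i / p i) • (1 : Matrix ι ι ℂ) - Y)ᴴ * τ i *
      ((d i / p i) • (1 : Matrix ι ι ℂ) - Y)) = (d i / p i) ^ 2 • τ i - (d i / p i) • (Yᴴ * τ i)
        - (d i / p i) • (τ i * Y) + Yᴴ * τ i * Y := by
      rw [conjTranspose_sub, conjTranspose_smul, conjTranspose_one, star_trivial]
      simp only [Matrix.sub_mul, Matrix.mul_sub, Matrix.smul_mul, Matrix.mul_smul, Matrix.one_mul,
        Matrix.mul_one]
      module
    rw [e]
    simp only [trace_add, trace_sub, trace_smul, Matrix.mul_smul, Matrix.smul_mul, Complex.add_re,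
      Complex.sub_re, Complex.smul_re, smul_eq_mul, (hτ i).2, Complex.one_re]
    rcases (hp i).eq_or_lt with h | h
    · simp [← h, hd i h.symm]
    · field_simp
  simp only [hterm, Finset.sum_add_distrib, Finset.sum_sub_distrib, ← Complex.re_sum,
    ← trace_sum, ← Matrix.mul_sum, ← Matrix.sum_mul, ← hδ, ← hMp] at hnn
  have hpsd : (K - K * M * K).PosSemidef := by
    have : K - K * M * K = hM.1.spectralMap
        (fun x => 1 / (x + ε) - 1 / (x + ε) * x * (1 / (x + ε))) := by
      rw [← IsHermitian.spectralMap_sub, ← IsHermitian.spectralMap_mul,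
        ← IsHermitian.spectralMap_mul, IsHermitian.spectralMap_id]
    rw [this]
    refine hM.1.spectralMap_posSemidef fun i => ?_
    have hx := hM.eigenvalues_nonneg i
    set x := hM.1.eigenvalues i
    have : 1 / (x + ε) - 1 / (x + ε) * x * (1 / (x + ε)) = ε / (x + ε) ^ 2 := by
      field_simp
      ring
    rw [this]
    positivity
  have h2 := (Complex.nonneg_iff.1 (hpsd.conjTranspose_mul_mul_same δ).trace_nonneg).1
  rw [hδH, Matrix.mul_sub, Matrix.sub_mul, trace_sub, Complex.sub_re] at h2
  rw [hYH, hY] at hnn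
  simp only [Matrix.mul_assoc] at hnn h2 ⊢
  linarith

lemma spectralMap_congr {A B : Matrix ι ι ℂ} (h : A = B) (hA : A.IsHermitian)
    (hB : B.IsHermitian) (f : ℝ → ℝ) : hA.spectralMap f = hB.spectralMap f := by
  subst h
  rfl

/-- Along the segment from `∑ p i • τ i` to `∑ r i • τ i`, the increments of the derivative of the
quantum relative entropy are bounded by those of the classical one. -/
lemma trace_mul_log_segment_le {τ : κ → Matrix ι ι ℂ} (hτ : ∀ i, IsDensityMatrix (τ i))
    {p d : κ → ℝ} (hp : ∀ i, 0 ≤ p i) (hpd : ∀ i, 0 ≤ p i + d i) (hd : ∀ i, p i = 0 → d i = 0)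
    {A : ℝ → Matrix ι ι ℂ} {δ : Matrix ι ι ℂ} (hAτ : ∀ t, A t = ∑ i, (p i + t * d i) • τ i)
    (hδ : δ = ∑ i, d i • τ i) (hA : ∀ t, 0 ≤ t → t ≤ 1 → (A t).PosSemidef)
    (hAH : ∀ t, (A t).IsHermitian) {ε : ℝ} (hε : 0 < ε) {T : ℝ} (hT0 : 0 ≤ T) (hT1 : T < 1) :
    (δ * ((hAH T).spectralMap (fun x => Real.log (x + ε)) -
      (hAH 0).spectralMap (fun x => Real.log (x + ε)))).trace.re ≤
      ∑ i, d i * (Real.log (p i + T * d i) - Real.log (p i)) := by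
  set φ : ℝ → ℝ := fun t => (δ * (hAH t).spectralMap (fun x => Real.log (x + ε))).trace.re with hφ
  set Φ : ℝ → ℝ := fun t => ∑ i, d i * Real.log (p i + t * d i) with hΦ
  have hsub : ∀ s t, A t - A s = (t - s) • δ := by
    intro s t
    rw [hAτ, hAτ, hδ, ← Finset.sum_sub_distrib, Finset.smul_sum]
    refine Finset.sum_congr rfl fun i _ => ?_
    rw [smul_smul, ← sub_smul]
    congr 1
    ring
  have hlow : ∀ i t, 0 ≤ t → t ≤ T → (1 - T) * p i ≤ p i + t * d i := by
    intro i t h0 h1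
    nlinarith [hp i, hpd i, mul_nonneg h0 (hpd i), mul_nonneg (sub_nonneg.2 h1) (hp i)]
  have hquad : ∀ t, 0 ≤ t → t ≤ T →
      (δ * (hAH t).spectralMap (fun x => 1 / (x + ε)) * δ).trace.re ≤
        ∑ i, d i ^ 2 / (p i + t * d i) := by
    intro t h0 h1
    refine trace_mul_spectralMap_mul_le_sum_sq_div hτ (fun i => ?_) (fun i hi => ?_)
      (hA t h0 (h1.trans hT1.le)) (hAτ t) hδ hε
    · exact (mul_nonneg (by linarith) (hp i)).trans (hlow i t h0 h1)
    · have h2 := hlow i t h0 h1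
      rw [hi] at h2
      refine hd i (le_antisymm ?_ (hp i))
      by_contra h3
      exact absurd h2 (not_le.2 (mul_pos (by linarith) (not_le.1 h3)))
  have hmain : φ T - Φ T ≤ φ 0 - Φ 0 := by
    refine le_of_forall_sub_le_mul_sq (F := fun t => φ t - Φ t)
      (C := ∑ i, |d i| ^ 3 / (2 * ((1 - T) * p i) ^ 2)) hT0 fun s t hs hst ht => ?_
    have hts : 0 < t - s := sub_pos.2 hst
    have h1 := IsHermitian.trace_sub_mul_log_sub_le (hA t (hs.trans hst.le) (ht.trans hT1.le))
      (hA s hs (hst.le.trans (ht.trans hT1.le))) hε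
    rw [hsub s t] at h1
    simp only [Matrix.smul_mul, Matrix.mul_smul, trace_smul, Complex.smul_re, smul_eq_mul,
      Matrix.mul_sub, trace_sub, Complex.sub_re] at h1
    have h2 := hquad t (hs.trans hst.le) ht
    have h3 := hquad s hs (hst.le.trans ht)
    have h4 : ∀ i, 1 / 2 * (t - s) ^ 2 * (d i ^ 2 / (p i + t * d i) + d i ^ 2 / (p i + s * d i)) ≤
        (t - s) * (d i * Real.log (p i + t * d i) - d i * Real.log (p i + s * d i)) +
          (t - s) ^ 3 * (|d i| ^ 3 / (2 * ((1 - T) * p i) ^ 2)) := by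
      intro i
      rcases (hp i).eq_or_lt with h | h
      · simp [hd i h.symm]
      have hc : 0 < (1 - T) * p i := mul_pos (by linarith) h
      have ha := hlow i s hs (hst.le.trans ht)
      have hb := hlow i t (hs.trans hst.le) ht
      have h5 := half_sq_mul_le_sub_mul_log_sub_log (hc.trans_le ha) (hc.trans_le hb)
      have h6 : p i + t * d i - (p i + s * d i) = (t - s) * d i := by ring
      rw [h6, abs_mul, abs_of_pos hts, mul_pow, mul_pow] at h5
      have h7 : (t - s) ^ 3 * |d i| ^ 3 / (2 * ((p i + s * d i) * (p i + t * d i))) ≤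
          (t - s) ^ 3 * |d i| ^ 3 / (2 * ((1 - T) * p i) ^ 2) := by
        have hs0 := hc.le.trans ha
        rw [pow_two ((1 - T) * p i)]
        gcongr
      calc _ = 1 / 2 * ((t - s) ^ 2 * d i ^ 2) * (1 / (p i + s * d i) + 1 / (p i + t * d i)) := by
            ring
        _ ≤ _ := h5
        _ ≤ _ := add_le_add_right h7 _
        _ = _ := by ring
    have h5 := Finset.sum_le_sum fun i (_ : i ∈ Finset.univ) => h4 i
    rw [← Finset.mul_sum, Finset.sum_add_distrib, Finset.sum_add_distrib, ← Finset.mul_sum,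
      ← Finset.mul_sum, Finset.sum_sub_distrib] at h5
    have h6 : (t - s) * (φ t - φ s) ≤ (t - s) * (Φ t - Φ s) +
        (t - s) ^ 3 * ∑ i, |d i| ^ 3 / (2 * ((1 - T) * p i) ^ 2) := by
      refine le_trans ?_ h5
      rw [mul_sub]
      refine h1.trans ?_
      calc _ = 1 / 2 * (t - s) ^ 2 *
            ((δ * (hAH t).spectralMap (fun x => 1 / (x + ε)) * δ).trace.re +
              (δ * (hAH s).spectralMap (fun x => 1 / (x + ε)) * δ).trace.re) := by ring
        _ ≤ _ := by gcongr
    have h7 : (t - s) * (φ t - Φ t - (φ s - Φ s)) ≤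
        (t - s) * ((∑ i, |d i| ^ 3 / (2 * ((1 - T) * p i) ^ 2)) * (t - s) ^ 2) := by
      linarith
    exact le_of_mul_le_mul_left h7 hts
  rw [Matrix.mul_sub, trace_sub, Complex.sub_re]
  simp only [mul_sub, Finset.sum_sub_distrib]
  simp only [hφ, hΦ, zero_mul, add_zero] at hmain
  linarith

lemma trace_add_mul_log_sub_le_sum_mul_log {τ : κ → Matrix ι ι ℂ}
    (hτ : ∀ i, IsDensityMatrix (τ i)) {p r : κ → ℝ} (hp : ∀ i, 0 ≤ p i) (hr : ∀ i, 0 ≤ r i)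
    (hpr : ∀ i, p i = 0 → r i = 0) (hsum : ∑ i, r i = ∑ i, p i) {σ μ : Matrix ι ι ℂ}
    (hσ : σ.IsHermitian) (hμ : μ.IsHermitian)
    (hσr : σ = ∑ i, r i • τ i) (hμp : μ = ∑ i, p i • τ i) {ε : ℝ} (hε : 0 < ε) :
    ((σ + (ε : ℂ) • 1) * (hσ.spectralMap (fun x => Real.log (x + ε)) -
      hμ.spectralMap (fun x => Real.log (x + ε)))).trace.re ≤
      ∑ i, r i * (Real.log (r i) - Real.log (p i)) := by
  set d : κ → ℝ := fun i => r i - p i with hd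
  set A : ℝ → Matrix ι ι ℂ := fun t => ∑ i, (p i + t * d i) • τ i with hAdef
  set δ : Matrix ι ι ℂ := ∑ i, d i • τ i with hδ
  have hq : ∀ i t, 0 ≤ t → t ≤ 1 → 0 ≤ p i + t * d i := by
    intro i t h0 h1
    have : p i + t * d i = (1 - t) * p i + t * r i := by rw [hd]; ring
    rw [this]
    exact add_nonneg (mul_nonneg (sub_nonneg.2 h1) (hp i)) (mul_nonneg h0 (hr i))
  have hA : ∀ t, 0 ≤ t → t ≤ 1 → (A t).PosSemidef := fun t h0 h1 =>
    posSemidef_sum _ fun i _ => (hτ i).1.smul (hq i t h0 h1)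
  have hAH : ∀ t, (A t).IsHermitian := by
    intro t
    rw [IsHermitian, hAdef, conjTranspose_sum]
    exact Finset.sum_congr rfl fun i _ => by rw [conjTranspose_smul, (hτ i).1.1.eq, star_trivial]
  have hA0 : A 0 = μ := by simp [hAdef, hμp]
  have hA1 : A 1 = σ := by simp [hAdef, hσr, hd]
  have hd0 : ∀ i, p i = 0 → d i = 0 := fun i hi => by simp [hd, hi, hpr i hi]
  have hdsum : ∑ i, d i = 0 := by rw [hd, Finset.sum_sub_distrib, hsum, sub_self]
  have hδtr : δ.trace.re = 0 := by
    rw [hδ, trace_sum, Complex.re_sum, ← hdsum]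
    exact Finset.sum_congr rfl fun i _ => by simp [(hτ i).2]
  have hsub : ∀ s t, A t - A s = (t - s) • δ := by
    intro s t
    rw [hδ, ← Finset.sum_sub_distrib, Finset.smul_sum]
    refine Finset.sum_congr rfl fun i _ => ?_
    rw [smul_smul, ← sub_smul]
    congr 1
    ring
  set L : ℝ → Matrix ι ι ℂ := fun t => (hAH t).spectralMap (fun x => Real.log (x + ε)) with hL
  have hLσ : hσ.spectralMap (fun x => Real.log (x + ε)) = L 1 :=
    spectralMap_congr hA1.symm _ _ _
  have hLμ : hμ.spectralMap (fun x => Real.log (x + ε)) = L 0 :=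
    spectralMap_congr hA0.symm _ _ _
  rw [hLσ, hLμ, ← hA1]
  have hmain := le_of_forall_sub_le_mul_sq (F := fun t =>
    ((A t + (ε : ℂ) • 1) * (L t - L 0)).trace.re -
      ∑ i, (p i + t * d i) * (Real.log (p i + t * d i) - Real.log (p i)))
    (C := 1 / ε * (δ * δ).trace.re) (T := 1) zero_le_one ?_
  · have h1 : ∀ i, p i + 1 * d i = r i := fun i => by simp [hd]
    simp only [h1, sub_self, trace_zero, Complex.zero_re, zero_mul, add_zero,
      mul_zero, Finset.sum_const_zero, tsub_le_iff_right, zero_add] at hmain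
    exact hmain
  intro s t hs hst ht
  have hts : 0 < t - s := sub_pos.2 hst
  have e1 : (A t + (ε : ℂ) • 1) * (L t - L 0) = (A s + (ε : ℂ) • 1) * (L s - L 0) +
      ((A t + (ε : ℂ) • 1) * (L t - L s) + (A t - A s) * (L s - L 0)) := by
    noncomm_ring
  have h1 := IsHermitian.trace_add_mul_log_sub_le (hA t (hs.trans hst.le) ht)
    (hA s hs (hst.le.trans ht)) hε
  have h2 := trace_mul_log_segment_le hτ hp (fun i => by simpa using hq i 1 zero_le_one le_rfl) hd0
    (fun t => rfl) hδ hA hAH hε hs (hst.trans_le ht)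
  have h3 : (t - s) * ∑ i, d i * (Real.log (p i + s * d i) - Real.log (p i)) +
      ∑ i, (p i + s * d i) * (Real.log (p i + s * d i) - Real.log (p i)) ≤
      ∑ i, (p i + t * d i) * (Real.log (p i + t * d i) - Real.log (p i)) := by
    have h4 : ∀ i, (t - s) * (d i * (Real.log (p i + s * d i) - Real.log (p i))) +
        (p i + s * d i) * (Real.log (p i + s * d i) - Real.log (p i)) + (t - s) * d i ≤
        (p i + t * d i) * (Real.log (p i + t * d i) - Real.log (p i)) := by
      intro i
      rcases (hp i).eq_or_lt with h | h
      · simp [hd0 i h.symm, ← h]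
      have hqs : 0 < p i + s * d i := by
        have : p i + s * d i = (1 - s) * p i + s * r i := by rw [hd]; ring
        rw [this]
        exact add_pos_of_pos_of_nonneg (mul_pos (by linarith) h) (mul_nonneg hs (hr i))
      have hqt := hq i t (hs.trans hst.le) ht
      have h5 : (p i + t * d i) - (p i + s * d i) ≤
          (p i + t * d i) * (Real.log (p i + t * d i) - Real.log (p i + s * d i)) := by
        rcases hqt.eq_or_lt with h | h
        · rw [← h]
          linarith
        · have h6 := Real.one_sub_inv_le_log_of_pos (div_pos h hqs)
          rw [Real.log_div h.ne' hqs.ne'] at h6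
          refine le_trans (le_of_eq ?_) (mul_le_mul_of_nonneg_left h6 h.le)
          field_simp
      linarith
    have h5 := Finset.sum_le_sum fun i (_ : i ∈ Finset.univ) => h4 i
    rw [Finset.sum_add_distrib, Finset.sum_add_distrib, ← Finset.mul_sum, ← Finset.mul_sum, hdsum,
      mul_zero, add_zero] at h5
    exact h5
  have h4 : (A t - A s).trace.re = 0 := by
    rw [hsub, trace_smul, Complex.smul_re, hδtr, smul_zero]
  have h5 : ((A t - A s) * (A t - A s)).trace.re = (t - s) ^ 2 * (δ * δ).trace.re := by
    rw [hsub, Matrix.smul_mul, Matrix.mul_smul, smul_smul, trace_smul, Complex.smul_re, smul_eq_mul,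
      pow_two]
  have h6 : ((A t - A s) * (L s - L 0)).trace.re = (t - s) * (δ * (L s - L 0)).trace.re := by
    rw [hsub, Matrix.smul_mul, trace_smul, Complex.smul_re, smul_eq_mul]
  have h7 := mul_le_mul_of_nonneg_left h2 hts.le
  rw [h4, h5] at h1
  simp only [e1, trace_add, Complex.add_re, h6]
  linarith

/-- Preparing states from a classical label does not increase relative entropy. -/
theorem relEnt_sum_smul_le_sum_mul_log {τ : κ → Matrix ι ι ℂ}
    (hτ : ∀ i, IsDensityMatrix (τ i)) {p r : κ → ℝ} (hp : ∀ i, 0 ≤ p i) (hr : ∀ i, 0 ≤ r i)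
    (hpr : ∀ i, p i = 0 → r i = 0) (hsum : ∑ i, r i = ∑ i, p i) :
    relEnt (∑ i, r i • τ i) (∑ i, p i • τ i) ≤
      ∑ i, r i * (Real.log (r i) - Real.log (p i)) := by
  have hσ : (∑ i, r i • τ i).PosSemidef := posSemidef_sum _ fun i _ => (hτ i).1.smul (hr i)
  have hμ : (∑ i, p i • τ i).PosSemidef := posSemidef_sum _ fun i _ => (hτ i).1.smul (hp i)
  have hreg := fun (ε : ℝ) (hε : 0 < ε) =>
    trace_add_mul_log_sub_le_sum_mul_log hτ hp hr hpr hsum hσ.1 hμ.1 rfl rfl hε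
  rw [relEnt, dif_pos ⟨hσ.1, hμ.1⟩]
  have hQ : ∀ v : ι → ℂ, (star v ⬝ᵥ (∑ i, p i • τ i) *ᵥ v).re = 0 →
      (star v ⬝ᵥ (∑ i, r i • τ i) *ᵥ v).re = 0 := by
    intro v
    have hlin : ∀ c : κ → ℝ, (star v ⬝ᵥ (∑ i, c i • τ i) *ᵥ v).re =
        ∑ i, c i * (star v ⬝ᵥ τ i *ᵥ v).re := by
      intro c
      rw [Matrix.sum_mulVec, dotProduct_sum, Complex.re_sum]
      exact Finset.sum_congr rfl fun i _ => by
        rw [smul_mulVec, dotProduct_smul, Complex.smul_re, smul_eq_mul]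
    have hnn : ∀ i ∈ Finset.univ, 0 ≤ p i * (star v ⬝ᵥ τ i *ᵥ v).re := fun i _ =>
      mul_nonneg (hp i) ((hτ i).1.re_dotProduct_nonneg v)
    rw [hlin, hlin, Finset.sum_eq_zero_iff_of_nonneg hnn]
    intro h
    refine Finset.sum_eq_zero fun i hi => ?_
    rcases mul_eq_zero.1 (h i hi) with h | h
    · rw [hpr i h, zero_mul]
    · rw [h, mul_zero]
  generalize (∑ i, r i • τ i) = σ at *
  generalize (∑ i, p i • τ i) = μ at *
  set q : ι → ℝ := fun j => ((star (fun i => hμ.1.eigenvectorBasis j i)) ⬝ᵥ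
    σ.mulVec (fun i => hμ.1.eigenvectorBasis j i)).re with hq
  have hq0 : ∀ j, hμ.1.eigenvalues j = 0 → q j = 0 := by
    intro j hj
    refine hQ _ ?_
    have := hμ.1.mulVec_eigenvectorBasis j
    rw [hj, zero_smul] at this
    rw [show (fun i => hμ.1.eigenvectorBasis j i) = ⇑(hμ.1.eigenvectorBasis j) from rfl, this]
    simp
  have htr : ∀ f : ℝ → ℝ, (σ * hμ.1.spectralMap f).trace.re =
      ∑ j, q j * f (hμ.1.eigenvalues j) := by
    intro f
    rw [IsHermitian.spectralMap, ← Matrix.mul_assoc, Matrix.trace_mul_comm, ← Matrix.mul_assoc,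
      ← Matrix.mul_assoc, trace, Complex.re_sum]
    refine Finset.sum_congr rfl fun j _ => ?_
    rw [diag_apply, mul_diagonal, Complex.re_mul_ofReal]
    congr 2
    rw [Matrix.mul_assoc, Matrix.mul_apply]
    rfl
  have hreg' : ∀ ε : ℝ, 0 < ε → (∑ i, (hσ.1.eigenvalues i + ε) * Real.log (hσ.1.eigenvalues i + ε))
      - ∑ j, (q j + ε) * Real.log (hμ.1.eigenvalues j + ε) ≤
      ∑ i, r i * (Real.log (r i) - Real.log (p i)) := by
    intro ε hε
    refine le_trans (le_of_eq ?_) (hreg ε hε)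
    rw [Matrix.mul_sub, Matrix.add_mul, Matrix.add_mul, Matrix.smul_mul, Matrix.smul_mul,
      Matrix.one_mul, Matrix.one_mul, trace_sub, trace_add, trace_add, trace_smul, trace_smul,
      Complex.sub_re, Complex.add_re, Complex.add_re, htr, smul_eq_mul, smul_eq_mul,
      Complex.re_ofReal_mul, Complex.re_ofReal_mul, IsHermitian.trace_spectralMap,
      IsHermitian.trace_spectralMap]
    have : (σ * hσ.1.spectralMap fun x => Real.log (x + ε)).trace.re =
        ∑ i, hσ.1.eigenvalues i * Real.log (hσ.1.eigenvalues i + ε) := by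
      conv_rhs => rw [← hσ.1.trace_spectralMap (fun x => x * Real.log (x + ε)),
        ← hσ.1.spectralMap_mul, hσ.1.spectralMap_id]
    rw [this]
    simp only [add_mul, Finset.sum_add_distrib, Finset.mul_sum]
  have hid : Filter.Tendsto (fun ε : ℝ => ε) (nhdsWithin 0 (Set.Ioi 0)) (nhds 0) :=
    Filter.tendsto_id.mono_left nhdsWithin_le_nhds
  have hadd : ∀ x : ℝ, Filter.Tendsto (fun ε : ℝ => x + ε) (nhdsWithin 0 (Set.Ioi 0)) (nhds x) := by
    intro x
    simpa using hid.const_add x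
  refine le_of_tendsto (x := nhdsWithin (0 : ℝ) (Set.Ioi 0)) (Filter.Tendsto.sub
    (tendsto_finsetSum _ fun i _ => ?_) (tendsto_finsetSum _ fun j _ => ?_))
    (Filter.eventually_of_mem self_mem_nhdsWithin hreg')
  · exact (Real.continuous_mul_log.tendsto _).comp (hadd _)
  · split_ifs with h
    · rw [mul_comm]
      exact (hadd _).mul ((Real.continuousAt_log h.ne').tendsto.comp (hadd _))
    · have h0 : hμ.1.eigenvalues j = 0 := le_antisymm (not_lt.1 h) (hμ.eigenvalues_nonneg j)
      have := (Real.continuous_mul_log.tendsto 0).comp hid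
      simpa [h0, hq0 j h0, Function.comp_def] using this

end PreparedStates

section Instrument

variable {n m : ℕ} {Ω K : Type*} [Fintype K] {V : Ω → K → Matrix (Fin m) (Fin n) ℂ}

lemma posSemidef_instAct (ω : Ω) {ρ : Matrix (Fin n) (Fin n) ℂ} (hρ : ρ.PosSemidef) :
    (instAct V ω ρ).PosSemidef :=
  posSemidef_sum _ fun k _ => hρ.mul_mul_conjTranspose_same (V ω k)

lemma trace_instAct (ω : Ω) (ρ : Matrix (Fin n) (Fin n) ℂ) :
    (instAct V ω ρ).trace = (povm V ω * ρ).trace := by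
  rw [instAct, povm, trace_sum, Matrix.sum_mul, trace_sum]
  exact Finset.sum_congr rfl fun k _ => by
    rw [Matrix.trace_mul_comm, ← Matrix.mul_assoc]

lemma probOut_nonneg (ω : Ω) {ρ : Matrix (Fin n) (Fin n) ℂ} (hρ : ρ.PosSemidef) :
    0 ≤ probOut V ρ ω := by
  rw [probOut, ← trace_instAct]
  exact (Complex.nonneg_iff.1 (posSemidef_instAct ω hρ).trace_nonneg).1

lemma sum_trace_povm_mul [Fintype Ω] (hV : ∑ ω, ∑ k, (V ω k)ᴴ * V ω k = 1)
    (ρ : Matrix (Fin n) (Fin n) ℂ) : ∑ ω, (povm V ω * ρ).trace = ρ.trace := by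
  rw [← trace_sum, ← Matrix.sum_mul]
  simp only [povm, hV, Matrix.one_mul]

lemma isDensityMatrix_sum_instAct [Fintype Ω] (hV : ∑ ω, ∑ k, (V ω k)ᴴ * V ω k = 1)
    {ρ : Matrix (Fin n) (Fin n) ℂ} (hρ : IsDensityMatrix ρ) :
    IsDensityMatrix (∑ ω, instAct V ω ρ) := by
  refine ⟨posSemidef_sum _ fun ω _ => posSemidef_instAct ω hρ.1, ?_⟩
  simp only [trace_sum, trace_instAct, sum_trace_povm_mul hV, hρ.2]

lemma probOut_sum_smul {A : Type*} [Fintype A] (p : A → ℝ) (ρ : A → Matrix (Fin n) (Fin n) ℂ)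
    (ω : Ω) : probOut V (∑ α, p α • ρ α) ω = ∑ α, p α * probOut V (ρ α) ω := by
  rw [probOut, Matrix.mul_sum, trace_sum, Complex.re_sum]
  exact Finset.sum_congr rfl fun α _ => by
    rw [Matrix.mul_smul, trace_smul, Complex.smul_re, smul_eq_mul, probOut]

end Instrument

lemma IsDensityMatrix.kronecker {ι κ : Type*} [Fintype ι] [Fintype κ]
    {ρ : Matrix ι ι ℂ} {σ : Matrix κ κ ℂ} (hρ : IsDensityMatrix ρ) (hσ : IsDensityMatrix σ) :
    IsDensityMatrix (ρ ⊗ₖ σ) :=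
  ⟨hρ.1.kronecker hσ.1, by rw [trace_kronecker, hρ.2, hσ.2, one_mul]⟩

theorem strengthened_scutaru_bound {A Ω K : Type*} [Fintype A] [Fintype Ω] [Fintype K]
    [Nonempty A] [Nonempty Ω] [Nonempty K] {n m : ℕ} (hn : 1 ≤ n) (hm : 1 ≤ m)
    (p : A → ℝ) (hp0 : ∀ α, 0 ≤ p α) (hp1 : ∑ α, p α = 1)
    (ρ : A → Matrix (Fin n) (Fin n) ℂ) (hρ : ∀ α, IsDensityMatrix (ρ α))
    (V : Ω → K → Matrix (Fin m) (Fin n) ℂ)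
    (hV : ∑ ω, ∑ k, (V ω k)ᴴ * V ω k = 1)
    (η : Matrix (Fin n) (Fin n) ℂ) (hη : η = ∑ α, p α • ρ α)
    (Pf : Ω → ℝ) (hPf : ∀ ω, Pf ω = probOut V η ω)
    (ηfα : A → Matrix (Fin m) (Fin m) ℂ) (hηfα : ∀ α, ηfα α = ∑ ω, instAct V ω (ρ α))
    (εif : Ω → Matrix (Fin n × Fin m) (Fin n × Fin m) ℂ)
    (hεif : ∀ ω, 0 < Pf ω → εif ω =
      ∑ α, if 0 < p α * probOut V (ρ α) ω then
        ((p α * probOut V (ρ α) ω) / Pf ω) • (ρ α ⊗ₖ ηfα α) else 0) :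
    (∑ ω, Pf ω • εif ω = ∑ α, p α • (ρ α ⊗ₖ ηfα α)) ∧
    Ic p ρ V ≥ holevoChi Pf εif := by
  set τ : A → Matrix (Fin n × Fin m) (Fin n × Fin m) ℂ := fun α => ρ α ⊗ₖ ηfα α with hτdef
  have hτ : ∀ α, IsDensityMatrix (τ α) := fun α =>
    (hρ α).kronecker (hηfα α ▸ isDensityMatrix_sum_instAct hV (hρ α))
  have hP0 : ∀ α ω, 0 ≤ p α * probOut V (ρ α) ω := fun α ω =>
    mul_nonneg (hp0 α) (probOut_nonneg ω (hρ α).1)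
  have hPfsum : ∀ ω, Pf ω = ∑ α, p α * probOut V (ρ α) ω := fun ω => by
    rw [hPf, hη, probOut_sum_smul]
  have hPf0 : ∀ ω, 0 ≤ Pf ω := fun ω => by
    rw [hPfsum]
    exact Finset.sum_nonneg fun α _ => hP0 α ω
  have hle : ∀ α ω, p α * probOut V (ρ α) ω ≤ Pf ω := fun α ω => by
    rw [hPfsum]
    exact Finset.single_le_sum (fun β _ => hP0 β ω) (Finset.mem_univ α)
  have hε : ∀ ω, 0 < Pf ω → εif ω = ∑ α, (p α * probOut V (ρ α) ω / Pf ω) • τ α := by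
    intro ω hω
    rw [hεif ω hω]
    refine Finset.sum_congr rfl fun α _ => ?_
    split_ifs with h
    · rfl
    · rw [le_antisymm (not_lt.1 h) (hP0 α ω), zero_div, zero_smul]
  have hPsum : ∀ α, ∑ ω, probOut V (ρ α) ω = 1 := fun α => by
    simp only [probOut, ← Complex.re_sum, sum_trace_povm_mul hV, (hρ α).2, Complex.one_re]
  have hbary : ∑ ω, Pf ω • εif ω = ∑ α, p α • τ α := by
    have h1 : ∀ ω, Pf ω • εif ω = ∑ α, (p α * probOut V (ρ α) ω) • τ α := by
      intro ω
      rcases (hPf0 ω).eq_or_lt with h | h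
      · rw [← h, zero_smul]
        refine (Finset.sum_eq_zero fun α _ => ?_).symm
        rw [le_antisymm (h ▸ hle α ω) (hP0 α ω), zero_smul]
      · rw [hε ω h, Finset.smul_sum]
        refine Finset.sum_congr rfl fun α _ => ?_
        rw [smul_smul, mul_div_cancel₀ _ h.ne']
    rw [Finset.sum_congr rfl fun ω _ => h1 ω, Finset.sum_comm]
    refine Finset.sum_congr rfl fun α _ => ?_
    rw [← Finset.sum_smul, ← Finset.mul_sum, hPsum, mul_one]
  refine ⟨hbary, ?_⟩
  rw [ge_iff_le, holevoChi, Ic, Finset.sum_comm, hbary]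
  refine Finset.sum_le_sum fun ω _ => ?_
  split_ifs with hω
  · have h1 := relEnt_sum_smul_le_sum_mul_log hτ hp0
      (r := fun α => p α * probOut V (ρ α) ω / Pf ω) (fun α => div_nonneg (hP0 α ω) (hPf0 ω))
      (fun α h => by simp [h]) (by rw [← Finset.sum_div, ← hPfsum, div_self hω.ne', hp1])
    rw [← hε ω hω] at h1
    refine (mul_le_mul_of_nonneg_left h1 (hPf0 ω)).trans_eq ?_
    rw [Finset.mul_sum]
    refine Finset.sum_congr rfl fun α _ => ?_
    split_ifs with h
    · have hpα : p α ≠ 0 := fun h0 => by simp [h0] at h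
      rw [← hη, ← hPf, ← mul_assoc, mul_div_cancel₀ _ hω.ne',
        ← Real.log_div (div_ne_zero h.ne' hω.ne') hpα, div_div, mul_comm (Pf ω)]
    · rw [le_antisymm (not_lt.1 h) (hP0 α ω)]
      simp
  · refine Finset.sum_nonneg fun α _ => ?_
    rw [if_neg (not_lt.2 ((hle α ω).trans (not_lt.1 hω)))]

end
end
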